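/- Let L ≥ 2 and n₀, n_L be fixed, consider rectangular (L,w)-DLNs, and let θ have i.i.d. N(0, w^{−1}) entries (the case γ = 1). Suppose the set of matrices minimizing C is nonempty, has Lebesgue measure zero in ℝ^{n_L×n₀}, and does not contain the zero matrix. Then, as w → ∞, d_m ≍ 1 and d_s ≍ 1. -/

import Mathlib

open MeasureTheory ProbabilityTheory

noncomputable section

/-- Index set for the parameters of a rectangular `(L,w)`-DLN with input dimension `n0`
and output dimension `nL`: entries of `W₁ ∈ ℝ^{w×n0}`, of the `L-2` hidden matrices
`W₂,…,W_{L-1} ∈ ℝ^{w×w}`, and of `W_L ∈ ℝ^{nL×w}`. -/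
abbrev DLNIdx (n0 nL w L : ℕ) :=
  (Fin w × Fin n0) ⊕ (Fin (L - 2) × Fin w × Fin w) ⊕ (Fin nL × Fin w)

/-- The (Euclidean) parameter space of a rectangular `(L,w)`-DLN, as a plain pi type. -/
abbrev DLNParams (n0 nL w L : ℕ) := DLNIdx n0 nL w L → ℝ

variable {n0 nL w L : ℕ}

/-- The first weight matrix `W₁`. -/
def dlnW1 (θ : DLNParams n0 nL w L) : Matrix (Fin w) (Fin n0) ℝ :=
  Matrix.of fun i j => θ (Sum.inl (i, j))

/-- The hidden weight matrices `W₂, …, W_{L-1}` (`dlnWmid θ ℓ = W_{ℓ+2}`). -/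
def dlnWmid (θ : DLNParams n0 nL w L) (ℓ : Fin (L - 2)) : Matrix (Fin w) (Fin w) ℝ :=
  Matrix.of fun i j => θ (Sum.inr (Sum.inl (ℓ, i, j)))

/-- The last weight matrix `W_L`. -/
def dlnWL (θ : DLNParams n0 nL w L) : Matrix (Fin nL) (Fin w) ℝ :=
  Matrix.of fun i j => θ (Sum.inr (Sum.inr (i, j)))

/-- The matrix `A_θ = W_L ⋯ W₁` realized by the network, as a function. -/
def dlnMatrix (θ : DLNParams n0 nL w L) : Fin nL → Fin n0 → ℝ :=
  fun i j => (dlnWL θ * (List.ofFn (dlnWmid θ)).reverse.prod * dlnW1 θ) i j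

/-- The loss `𝓛(θ) = C(A_θ)`. -/
def dlnLoss (C : (Fin nL → Fin n0 → ℝ) → ℝ) (θ : DLNParams n0 nL w L) : ℝ :=
  C (dlnMatrix θ)

/-- Euclidean distance between two parameter vectors. -/
def dlnDist (θ θ' : DLNParams n0 nL w L) : ℝ :=
  Real.sqrt (∑ i, (θ i - θ' i) ^ 2)

/-- `θ` is a global minimum of `𝓛`, i.e. `C (A_θ) = inf C`. -/
def DLNIsGlobalMin (C : (Fin nL → Fin n0 → ℝ) → ℝ) (θ : DLNParams n0 nL w L) : Prop :=
  ∀ A, C (dlnMatrix θ) ≤ C A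

/-- `θ` is a saddle of `𝓛`: a critical point at which `𝓛` has no local minimum. -/
def DLNIsSaddle (C : (Fin nL → Fin n0 → ℝ) → ℝ) (θ : DLNParams n0 nL w L) : Prop :=
  fderiv ℝ (dlnLoss C) θ = 0 ∧ ¬ IsLocalMin (dlnLoss C) θ

/-- `d_m`: Euclidean distance from `θ` to the set of global minima of `𝓛`. -/
def dlnDm (C : (Fin nL → Fin n0 → ℝ) → ℝ) (θ : DLNParams n0 nL w L) : ℝ :=
  sInf ((fun θ' => dlnDist θ θ') '' {θ' | DLNIsGlobalMin C θ'})

/-- `d_s`: Euclidean distance from `θ` to the set of saddles of `𝓛`. -/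
def dlnDs (C : (Fin nL → Fin n0 → ℝ) → ℝ) (θ : DLNParams n0 nL w L) : ℝ :=
  sInf ((fun θ' => dlnDist θ θ') '' {θ' | DLNIsSaddle C θ'})

/-- The law of a parameter vector with i.i.d. centered Gaussian `N(0, σ²)` entries. -/
def dlnGauss (n0 nL w L : ℕ) (σ2 : ℝ) : Measure (DLNParams n0 nL w L) :=
  Measure.pi fun _ => gaussianReal 0 (Real.toNNReal σ2)

namespace DLNAux

section prob
variable {κ : Type*} [Fintype κ]

lemma lintegral_pi_prod {μ : κ → Measure ℝ} [∀ i, IsProbabilityMeasure (μ i)]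
    (f : κ → ℝ → ENNReal) (hf : ∀ i, Measurable (f i)) :
    ∫⁻ z, ∏ i, f i (z i) ∂(Measure.pi μ) = ∏ i, ∫⁻ y, f i y ∂(μ i) := by
  have h := lintegral_prod_eq_prod_lintegral_of_indepFun (μ := Measure.pi μ) Finset.univ
    (fun i z => f i (z i)) (iIndepFun_pi (fun i => (hf i).aemeasurable))
    (fun i => (hf i).comp (measurable_pi_apply i))
  rw [h]
  refine Finset.prod_congr rfl fun i _ => ?_
  have := (measurePreserving_eval μ i).lintegral_comp (hf i)
  simpa using this

lemma mgf_pi (v : NNReal) (a : κ → ℝ) :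
    ∫⁻ z, ENNReal.ofReal (Real.exp (∑ k, a k * z k)) ∂(Measure.pi fun _ : κ => gaussianReal 0 v)
      = ENNReal.ofReal (Real.exp (v * (∑ k, a k ^ 2) / 2)) := by
  have h1 : ∀ z : κ → ℝ, ENNReal.ofReal (Real.exp (∑ k, a k * z k))
      = ∏ k, (fun y => ENNReal.ofReal (Real.exp (a k * y))) (z k) := by
    intro z
    rw [Real.exp_sum, ENNReal.ofReal_prod_of_nonneg]
    intros; positivity
  simp_rw [h1]
  rw [lintegral_pi_prod (fun k y => ENNReal.ofReal (Real.exp (a k * y))) (fun k => by fun_prop)]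
  have h2 : ∀ k, ∫⁻ y, ENNReal.ofReal (Real.exp (a k * y)) ∂(gaussianReal 0 v)
      = ENNReal.ofReal (Real.exp (v * a k ^ 2 / 2)) := by
    intro k
    rw [← ofReal_integral_eq_lintegral_ofReal]
    · have := congrFun (mgf_id_gaussianReal (μ := 0) (v := v)) (a k)
      simp only [mgf, id] at this
      rw [this]; simp
    · exact integrable_exp_mul_gaussianReal (a k)
    · exact Filter.Eventually.of_forall fun _ => by positivity
  simp_rw [h2]
  rw [← ENNReal.ofReal_prod_of_nonneg (fun _ _ => by positivity), ← Real.exp_sum,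
    Finset.mul_sum, Finset.sum_div]

lemma law_pi {ι : Type*} [Fintype ι] [DecidableEq ι] (v : NNReal) (a : ι → κ → ℝ)
    (ha : ∀ i j, (v : ℝ) * ∑ k, a i k * a j k = if i = j then 1 else 0) :
    (Measure.pi fun _ : κ => gaussianReal 0 v).map (fun z i => ∑ k, a i k * z k)
      = Measure.pi fun _ : ι => gaussianReal 0 1 := by
  have hm : Measurable (fun (z : κ → ℝ) (i : ι) => ∑ k, a i k * z k) := by fun_prop
  have : IsProbabilityMeasure ((Measure.pi fun _ : κ => gaussianReal 0 v).map
    (fun z i => ∑ k, a i k * z k)) := Measure.isProbabilityMeasure_map hm.aemeasurable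
  rw [← charFun_eq_pi_iff]
  intro t
  have h1 : charFun (((Measure.pi fun _ : κ => gaussianReal 0 v).map
      (fun z i => ∑ k, a i k * z k)).map (WithLp.toLp 2)) t
      = charFun ((Measure.pi fun _ : κ => gaussianReal 0 v).map (WithLp.toLp 2))
        (WithLp.toLp 2 fun k => ∑ i, t i * a i k) := by
    rw [Measure.map_map (WithLp.measurable_toLp _ _) hm]
    simp only [charFun]
    have hl1 : Measurable (WithLp.toLp 2 : (κ → ℝ) → EuclideanSpace ℝ κ) := WithLp.measurable_toLp _ _
    have hl2 : Measurable (WithLp.toLp 2 : (ι → ℝ) → EuclideanSpace ℝ ι) := WithLp.measurable_toLp _ _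
    rw [integral_map (hl2.comp hm).aemeasurable (by fun_prop),
      integral_map hl1.aemeasurable (by fun_prop)]
    congr 1
    ext z
    congr 3
    simp only [PiLp.inner_apply, Function.comp, RCLike.inner_apply, conj_trivial]
    simp_rw [Finset.mul_sum, Finset.sum_mul]
    rw [Finset.sum_comm]
    refine Finset.sum_congr rfl fun k _ => Finset.sum_congr rfl fun i _ => by ring
  rw [h1, charFun_pi]
  simp_rw [charFun_gaussianReal, ← Complex.exp_sum]
  congr 1
  simp only [Complex.ofReal_zero, mul_zero, zero_mul, zero_sub, NNReal.coe_one, Complex.ofReal_one, one_mul]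
  have : (v : ℝ) * ∑ k, (∑ i, t i * a i k) ^ 2 = ∑ i, t i ^ 2 := by
    calc (v : ℝ) * ∑ k, (∑ i, t i * a i k) ^ 2
        = ∑ i, ∑ j, t i * t j * ((v : ℝ) * ∑ k, a i k * a j k) := by
          simp_rw [sq, Finset.sum_mul_sum, Finset.mul_sum]
          rw [Finset.sum_comm]
          refine Finset.sum_congr rfl fun i _ => ?_
          rw [Finset.sum_comm]
          refine Finset.sum_congr rfl fun j _ => Finset.sum_congr rfl fun k _ => by ring
      _ = _ := by simp [ha, sq]
  have h2 : ((v : ℝ) : ℂ) * ∑ k, (((∑ i, t i * a i k : ℝ)) : ℂ) ^ 2 = ∑ i, (t i : ℂ) ^ 2 := by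
    exact_mod_cast this
  rw [Finset.sum_neg_distrib, Finset.sum_neg_distrib, ← Finset.sum_div, ← Finset.sum_div, ← h2,
    Finset.mul_sum]

lemma exists_lower_const : ∃ c q : ℝ, 0 < c ∧ 0 ≤ q ∧ q < 1 ∧ ∀ w : ℕ,
    (Measure.pi fun _ : Fin w => gaussianReal 0 1) {z | ∑ i, z i ^ 2 < c * w}
      ≤ ENNReal.ofReal (q ^ w) := by
  set Q : ℝ := ∫ y, Real.exp (-y ^ 2) ∂(gaussianReal 0 1) with hQ
  have hint : Integrable (fun y : ℝ => Real.exp (-y ^ 2)) (gaussianReal 0 1) := by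
    refine Integrable.of_bound (C := 1) (by fun_prop) (Filter.Eventually.of_forall fun y => ?_)
    rw [Real.norm_eq_abs, abs_of_pos (Real.exp_pos _), Real.exp_le_one_iff]
    nlinarith [sq_nonneg y]
  have hQ0 : 0 < Q := by
    rw [hQ, integral_pos_iff_support_of_nonneg (fun y => (Real.exp_pos _).le) hint]
    have : Function.support (fun y : ℝ => Real.exp (-y ^ 2)) = Set.univ := by
      ext y; simp [Real.exp_ne_zero]
    rw [this]; simp
  have hQ1 : Q < 1 := by
    have h : 0 < ∫ y, (1 - Real.exp (-y ^ 2)) ∂(gaussianReal 0 1) := by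
      refine (integral_pos_iff_support_of_nonneg (f := fun y => 1 - Real.exp (-y ^ 2)) ?_ ((integrable_const (1 : ℝ)).sub hint)).2 ?_; rotate_left
      · have : Function.support (fun y : ℝ => 1 - Real.exp (-y ^ 2)) = {0}ᶜ := by
          ext y
          simp only [Function.mem_support, Set.mem_compl_iff, Set.mem_singleton_iff]
          rw [not_iff_not, sub_eq_zero, eq_comm, Real.exp_eq_one_iff]
          simp
        rw [this, prob_compl_eq_one_sub (measurableSet_singleton 0)]
        have := nullSingletonClass_gaussianReal (μ := 0) (v := 1) one_ne_zero
        simp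
      · intro y
        simp only [Pi.zero_apply, sub_nonneg, Real.exp_le_one_iff]
        nlinarith [sq_nonneg y]
    rw [integral_sub (integrable_const _) hint] at h
    simp at h
    linarith
  refine ⟨-Real.log Q / 2, Real.exp (Real.log Q / 2), ?_, by positivity, ?_, fun w => ?_⟩
  · have := Real.log_neg hQ0 hQ1; linarith
  · have := Real.log_neg hQ0 hQ1
    rw [Real.exp_lt_one_iff]; linarith
  · set F : (Fin w → ℝ) → ENNReal := fun z => ENNReal.ofReal (Real.exp (-∑ i, z i ^ 2)) with hF
    have hFm : Measurable F := by fun_prop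
    have hFi : ∫⁻ z, F z ∂(Measure.pi fun _ : Fin w => gaussianReal 0 1)
        = ENNReal.ofReal (Q ^ w) := by
      have h1 : ∀ z, F z = ∏ k, (fun (_ : Fin w) (y : ℝ) => ENNReal.ofReal (Real.exp (-y ^ 2))) k (z k) := by
        intro z
        rw [hF]; simp only
        rw [← Finset.sum_neg_distrib, Real.exp_sum, ENNReal.ofReal_prod_of_nonneg]
        intros; positivity
      simp_rw [h1]
      rw [lintegral_pi_prod (fun (_ : Fin w) (y : ℝ) => ENNReal.ofReal (Real.exp (-y ^ 2)))
        (fun _ => by fun_prop)]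
      rw [← ofReal_integral_eq_lintegral_ofReal hint
        (Filter.Eventually.of_forall fun _ => by positivity)]
      rw [← hQ, ENNReal.ofReal_pow hQ0.le]; simp
    set T := ENNReal.ofReal (Real.exp (Real.log Q / 2 * w)) with hT
    have hT0 : T ≠ 0 := by rw [hT]; simp [Real.exp_pos]
    have hsub : {z : Fin w → ℝ | ∑ i, z i ^ 2 < -Real.log Q / 2 * w} ⊆ {z | T ≤ F z} := by
      intro z hz
      simp only [Set.mem_ofPred_eq] at hz ⊢
      apply ENNReal.ofReal_le_ofReal
      apply Real.exp_le_exp.mpr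
      linarith
    refine (measure_mono hsub).trans ?_
    refine (meas_ge_le_lintegral_div hFm.aemeasurable hT0 ENNReal.ofReal_ne_top).trans ?_
    rw [hFi, hT, ← ENNReal.ofReal_div_of_pos (Real.exp_pos _)]
    apply ENNReal.ofReal_le_ofReal
    rw [div_le_iff₀ (Real.exp_pos _), ← Real.exp_nat_mul, ← Real.exp_add]
    rw [show (w : ℝ) * (Real.log Q / 2) + Real.log Q / 2 * w = w * Real.log Q by ring,
      Real.exp_nat_mul, Real.exp_log hQ0]


/-- replace the coordinates in `s` of `x` by those of `z` -/
def mix (s : Set κ) [DecidablePred (· ∈ s)] (x z : κ → ℝ) : κ → ℝ := fun k => if k ∈ s then z k else x k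

lemma mix_map (s : Set κ) [DecidablePred (· ∈ s)] (ν : Measure ℝ) [IsProbabilityMeasure ν] :
    (((Measure.pi fun _ : κ => ν).prod (Measure.pi fun _ : κ => ν)).map
      (fun p => mix s p.1 p.2)) = Measure.pi fun _ : κ => ν := by
  have hm : Measurable (fun p : (κ → ℝ) × (κ → ℝ) => mix s p.1 p.2) := by
    unfold mix
    refine measurable_pi_lambda _ fun k => ?_
    by_cases hk : k ∈ s <;> simp [hk] <;> fun_prop
  refine (Measure.pi_eq fun t ht => ?_).symm
  rw [Measure.map_apply hm (MeasurableSet.univ_pi ht)]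
  have : (fun p : (κ → ℝ) × (κ → ℝ) => mix s p.1 p.2) ⁻¹' (Set.univ.pi t)
      = (Set.univ.pi fun k => if k ∈ s then Set.univ else t k) ×ˢ
        (Set.univ.pi fun k => if k ∈ s then t k else Set.univ) := by
    ext ⟨x, z⟩
    simp only [Set.mem_preimage, Set.mem_pi, Set.mem_univ, forall_true_left, Set.mem_prod, mix]
    constructor
    · intro h
      constructor <;> intro k <;> have := h k <;> by_cases hk : k ∈ s <;> simp_all
    · rintro ⟨h1, h2⟩ k
      have := h1 k; have := h2 k
      by_cases hk : k ∈ s <;> simp_all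
  rw [this, Measure.prod_prod, Measure.pi_pi, Measure.pi_pi, ← Finset.prod_mul_distrib]
  refine Finset.prod_congr rfl fun k _ => ?_
  by_cases hk : k ∈ s <;> simp [hk]

lemma measure_le_of_mix (s : Set κ) [DecidablePred (· ∈ s)] (ν : Measure ℝ) [IsProbabilityMeasure ν]
    (E : Set (κ → ℝ)) (hE : MeasurableSet E) (p : ENNReal)
    (h : ∀ x, (Measure.pi fun _ : κ => ν) {z | mix s x z ∈ E} ≤ p) :
    (Measure.pi fun _ : κ => ν) E ≤ p := by
  have hm : Measurable (fun p : (κ → ℝ) × (κ → ℝ) => mix s p.1 p.2) := by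
    unfold mix
    refine measurable_pi_lambda _ fun k => ?_
    by_cases hk : k ∈ s <;> simp [hk] <;> fun_prop
  conv_lhs => rw [← mix_map s ν]
  rw [Measure.map_apply hm hE, Measure.prod_apply (hm hE)]
  calc _ ≤ ∫⁻ _ : κ → ℝ, p ∂(Measure.pi fun _ : κ => ν) := lintegral_mono fun x => h x
    _ = p := by simp

end prob
end DLNAux

namespace DLNAux
section prob2
variable {κ : Type*} [Fintype κ] [DecidableEq κ]

/-- coefficient vector supported on the range of `e` -/
def coef {β : Type*} [Fintype β] (e : β → κ) (u : β → ℝ) (k : κ) : ℝ := ∑ j, if e j = k then u j else 0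

lemma coef_sum {β : Type*} [Fintype β] (e : β → κ) (u : β → ℝ) (z : κ → ℝ) :
    ∑ k, coef e u k * z k = ∑ j, u j * z (e j) := by
  unfold coef
  simp_rw [Finset.sum_mul]
  rw [Finset.sum_comm]
  simp


lemma coef_apply {β : Type*} [Fintype β] (e : β → κ) (he : Function.Injective e) (u : β → ℝ) (j : β) :
    coef e u (e j) = u j := by
  classical
  unfold coef
  simp [he.eq_iff]

lemma coef_sq {β : Type*} [Fintype β] (e : β → κ) (he : Function.Injective e) (u : β → ℝ) :
    ∑ k, coef e u k ^ 2 = ∑ j, u j ^ 2 := by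
  simp_rw [sq]
  rw [coef_sum]
  simp [coef_apply e he]

lemma lower_block {c q : ℝ}
    (hcq : ∀ w : ℕ, (Measure.pi fun _ : Fin w => gaussianReal 0 1) {z | ∑ i, z i ^ 2 < c * w}
      ≤ ENNReal.ofReal (q ^ w))
    {w n : ℕ} (s2 : NNReal) (hs : (s2 : ℝ) * w = 1) (e : Fin w → Fin n → κ)
    (he : ∀ i j i' j', e i j = e i' j' → i = i' ∧ j = j')
    (v : (κ → ℝ) → Fin n → ℝ) (hvm : Measurable v)
    (hv : ∀ θ θ' : κ → ℝ, (∀ k, (∀ i j, k ≠ e i j) → θ k = θ' k) → v θ = v θ') :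
    (Measure.pi fun _ : κ => gaussianReal 0 s2)
      {θ | ∑ i, (∑ j, θ (e i j) * v θ j) ^ 2 < c * ∑ j, v θ j ^ 2} ≤ ENNReal.ofReal (q ^ w) := by
  classical
  set s : Set κ := {k | ∃ i j, k = e i j} with hsdef
  have hw : (0 : ℝ) < w := by
    rcases Nat.eq_zero_or_pos w with h | h
    · simp [h] at hs
    · exact_mod_cast h
  refine measure_le_of_mix s _ _ ?_ _ fun x => ?_
  · have hvj : ∀ j, Measurable fun θ => v θ j := fun j => (measurable_pi_apply j).comp hvm
    exact measurableSet_lt (by fun_prop) (by fun_prop)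
  have h1 : ∀ z, v (mix s x z) = v x := fun z => hv _ _ fun k hk => by
    have : k ∉ s := by rintro ⟨i, j, h⟩; exact hk i j h
    simp [mix, this]
  have h2 : ∀ z i j, mix s x z (e i j) = z (e i j) := fun z i j => by
    have : e i j ∈ s := ⟨i, j, rfl⟩
    simp [mix, this]
  simp only [Set.mem_ofPred_eq, h1, h2]
  set u := v x with hu
  set U := ∑ j, u j ^ 2 with hU
  have hU0 : 0 ≤ U := Finset.sum_nonneg fun _ _ => sq_nonneg _
  rcases hU0.eq_or_lt with hz | hpos
  · rw [← hz]
    have : {z : κ → ℝ | ∑ i, (∑ j, z (e i j) * u j) ^ 2 < c * 0} = ∅ := by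
      ext z
      simp only [mul_zero, Set.mem_ofPred_eq, Set.mem_empty_iff_false, iff_false, not_lt]
      exact Finset.sum_nonneg fun _ _ => sq_nonneg _
    rw [this]; simp
  · set ρ : ℝ := Real.sqrt (w / U) with hρ
    have hρ2 : ρ ^ 2 = w / U := Real.sq_sqrt (by positivity)
    set a : Fin w → κ → ℝ := fun i => coef (e i) (fun j => ρ * u j) with ha
    have hlaw := law_pi s2 a (by
      intro i i'
      rw [ha]; simp only
      rw [coef_sum]
      by_cases hii : i = i'
      · subst hii
        simp only [if_true]
        have : ∀ j, coef (e i) (fun j => ρ * u j) (e i j) = ρ * u j :=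
          coef_apply (e i) (fun j j' h => (he _ _ _ _ h).2) _
        simp only [this]
        have : ∑ j, ρ * u j * (ρ * u j) = ρ ^ 2 * U := by
          rw [hU, Finset.mul_sum]; exact Finset.sum_congr rfl fun _ _ => by ring
        rw [this, hρ2, div_mul_cancel₀ _ hpos.ne', hs]
      · simp only [if_neg hii]
        have : ∀ j, coef (e i') (fun j => ρ * u j) (e i j) = 0 := by
          intro j
          unfold coef
          refine Finset.sum_eq_zero fun j' _ => if_neg fun h => hii (he _ _ _ _ h).1.symm
        simp [this])
    have hm : Measurable (fun (z : κ → ℝ) (i : Fin w) => ∑ k, a i k * z k) := by fun_prop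
    have := hcq w
    rw [← hlaw, Measure.map_apply hm (measurableSet_lt (by fun_prop) (by fun_prop))] at this
    refine le_trans (measure_mono ?_) this
    intro z hz
    simp only [Set.mem_ofPred_eq, Set.mem_preimage] at hz ⊢
    have h3 : ∀ i, ∑ k, a i k * z k = ρ * ∑ j, z (e i j) * u j := by
      intro i
      rw [ha]; simp only
      rw [coef_sum, Finset.mul_sum]
      exact Finset.sum_congr rfl fun _ _ => by ring
    simp only [h3, mul_pow, ← Finset.mul_sum]
    rw [hρ2]
    calc (w / U) * _ < w / U * (c * U) := by
          apply mul_lt_mul_of_pos_left hz; positivity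
      _ = c * w := by field_simp

lemma upper_row {w n : ℕ} (s2 : NNReal) (hs : (s2 : ℝ) * w = 1) (e : Fin n → κ)
    (he : Function.Injective e) (δ K : ℝ)
    (v : (κ → ℝ) → Fin n → ℝ) (hvm : Measurable v)
    (hv : ∀ θ θ' : κ → ℝ, (∀ k, (∀ j, k ≠ e j) → θ k = θ' k) → v θ = v θ') :
    (Measure.pi fun _ : κ => gaussianReal 0 s2)
      {θ | δ ≤ ∑ j, θ (e j) * v θ j ∧ ∑ j, v θ j ^ 2 ≤ K}
        ≤ ENNReal.ofReal (Real.exp (K / 2 - Real.sqrt w * δ)) := by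
  classical
  set s : Set κ := {k | ∃ j, k = e j} with hsdef
  refine measure_le_of_mix s _ _ ?_ _ fun x => ?_
  · have hvj : ∀ j, Measurable fun θ => v θ j := fun j => (measurable_pi_apply j).comp hvm
    have A1 : MeasurableSet {θ : κ → ℝ | δ ≤ ∑ j, θ (e j) * v θ j} :=
      measurableSet_le (by fun_prop) (by fun_prop)
    have A2 : MeasurableSet {θ : κ → ℝ | ∑ j, v θ j ^ 2 ≤ K} :=
      measurableSet_le (by fun_prop) (by fun_prop)
    exact A1.inter A2
  have h1 : ∀ z, v (mix s x z) = v x := fun z => hv _ _ fun k hk => by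
    have : k ∉ s := by rintro ⟨j, h⟩; exact hk j h
    simp [mix, this]
  have h2 : ∀ z j, mix s x z (e j) = z (e j) := fun z j => by
    have : e j ∈ s := ⟨j, rfl⟩
    simp [mix, this]
  simp only [Set.mem_ofPred_eq, h1, h2]
  set u := v x with hu
  by_cases hK : ∑ j, u j ^ 2 ≤ K
  swap
  · simp [hK]
  simp only [hK, and_true]
  set F : (κ → ℝ) → ENNReal := fun z =>
    ENNReal.ofReal (Real.exp (∑ k, coef e (fun j => Real.sqrt w * u j) k * z k)) with hF
  have hFm : Measurable F := by fun_prop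
  have hFi : ∫⁻ z, F z ∂(Measure.pi fun _ : κ => gaussianReal 0 s2)
      ≤ ENNReal.ofReal (Real.exp (K / 2)) := by
    rw [hF, mgf_pi]
    apply ENNReal.ofReal_le_ofReal
    apply Real.exp_le_exp.mpr
    rw [coef_sq e he]
    simp only [mul_pow, ← Finset.mul_sum]
    rw [Real.sq_sqrt (by positivity), ← mul_assoc, hs, one_mul]
    linarith
  set T := ENNReal.ofReal (Real.exp (Real.sqrt w * δ)) with hT
  have hT0 : T ≠ 0 := by rw [hT]; simp [Real.exp_pos]
  have hsub : {z : κ → ℝ | δ ≤ ∑ j, z (e j) * u j} ⊆ {z | T ≤ F z} := by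
    intro z hz
    simp only [Set.mem_ofPred_eq] at hz ⊢
    apply ENNReal.ofReal_le_ofReal
    apply Real.exp_le_exp.mpr
    rw [coef_sum]
    have : ∑ j, Real.sqrt w * u j * z (e j) = Real.sqrt w * ∑ j, z (e j) * u j := by
      rw [Finset.mul_sum]; exact Finset.sum_congr rfl fun _ _ => by ring
    rw [this]
    exact mul_le_mul_of_nonneg_left hz (Real.sqrt_nonneg _)
  refine (measure_mono hsub).trans ?_
  refine (meas_ge_le_lintegral_div hFm.aemeasurable hT0 ENNReal.ofReal_ne_top).trans ?_
  refine (ENNReal.div_le_div_right hFi _).trans ?_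
  rw [hT, ← ENNReal.ofReal_div_of_pos (Real.exp_pos _), ← Real.exp_sub]

/-- averaging over balls -/
lemma ball_average {n : ℕ} (f : EuclideanSpace ℝ (Fin n) → ℝ) (hfm : Measurable f)
    (hadd : ∀ x y, f (x + y) = f x + f y) (hneg : ∀ x, f (-x) = - f x)
    (u : EuclideanSpace ℝ (Fin n)) (hu : ‖u‖ ≤ 1) :
    ENNReal.ofReal (Real.exp (f u)) * volume (Metric.ball (0 : EuclideanSpace ℝ (Fin n)) 1)
      ≤ ∫⁻ x in Metric.ball (0 : EuclideanSpace ℝ (Fin n)) 2, ENNReal.ofReal (Real.exp (f x)) := by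
  set B := Metric.ball (0 : EuclideanSpace ℝ (Fin n)) 1 with hB
  have hBm : MeasurableSet B := measurableSet_ball
  set I := ∫⁻ h in B, ENNReal.ofReal (Real.exp (f h)) with hI
  have hneg' : ∫⁻ h in B, ENNReal.ofReal (Real.exp (- f h)) = I := by
    rw [hI, ← lintegral_indicator hBm, ← lintegral_indicator hBm,
      ← (Measure.measurePreserving_neg (volume : Measure (EuclideanSpace ℝ (Fin n)))).lintegral_comp
        (Measurable.indicator (by fun_prop) hBm)]
    congr 1
    ext h
    by_cases hh : h ∈ B
    · have : -h ∈ B := by simpa [hB] using hh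
      simp [hh, this, hneg]
    · have : -h ∉ B := by simpa [hB] using hh
      simp [hh, this]
  have h1 : volume B ≤ I := by
    have : 2 * volume B ≤ 2 * I := by
      calc 2 * volume B = ∫⁻ _ in B, 2 := by simp
        _ ≤ ∫⁻ h in B, (ENNReal.ofReal (Real.exp (f h)) + ENNReal.ofReal (Real.exp (- f h))) := by
            refine lintegral_mono fun h => ?_
            rw [← ENNReal.ofReal_add (Real.exp_pos _).le (Real.exp_pos _).le,
              show (2 : ENNReal) = ENNReal.ofReal 2 by simp]
            apply ENNReal.ofReal_le_ofReal
            have := Real.add_one_le_exp (f h); have := Real.add_one_le_exp (-f h)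
            linarith
        _ = I + I := by
            rw [lintegral_add_left (by fun_prop), hneg']
        _ = 2 * I := by rw [two_mul]
    exact (ENNReal.mul_le_mul_iff_right (by simp) (by simp)).1 this
  calc ENNReal.ofReal (Real.exp (f u)) * volume B ≤ ENNReal.ofReal (Real.exp (f u)) * I := by gcongr
    _ = ∫⁻ h in B, ENNReal.ofReal (Real.exp (f (u + h))) := by
        rw [hI, ← lintegral_const_mul _ (by fun_prop)]
        congr 1; ext h
        rw [hadd, Real.exp_add, ENNReal.ofReal_mul (Real.exp_pos _).le]
    _ = ∫⁻ h, (Metric.ball u 1).indicator (fun x => ENNReal.ofReal (Real.exp (f x))) (u + h) := by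
        rw [← lintegral_indicator hBm]
        congr 1; ext h
        by_cases hh : h ∈ B
        · have : u + h ∈ Metric.ball u 1 := by simpa [hB] using hh
          simp [hh, this]
        · have : u + h ∉ Metric.ball u 1 := by simpa [hB] using hh
          simp [hh, this]
    _ = ∫⁻ x in Metric.ball u 1, ENNReal.ofReal (Real.exp (f x)) := by
        rw [lintegral_add_left_eq_self, lintegral_indicator measurableSet_ball]
    _ ≤ _ := by
        refine lintegral_mono_set fun x hx => ?_
        simp only [Metric.mem_ball, dist_zero_right] at hx ⊢
        have h3 := norm_sub_norm_le x u
        rw [dist_eq_norm] at hx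
        linarith

end prob2
end DLNAux

namespace DLNAux
section opnorm
open scoped Matrix.Norms.L2Operator
variable {κ : Type*} [Fintype κ] [DecidableEq κ]

lemma exists_bilin_of_lt_norm {m n : ℕ} (A : Matrix (Fin m) (Fin n) ℝ) (K : ℝ) (hK : 0 ≤ K)
    (h : K < ‖A‖) : ∃ (x : EuclideanSpace ℝ (Fin m)) (y : EuclideanSpace ℝ (Fin n)),
      ‖x‖ ≤ 1 ∧ ‖y‖ ≤ 1 ∧ K ≤ ∑ i, ∑ j, x i * A i j * y j := by
  rw [Matrix.l2_opNorm_def] at h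
  obtain ⟨y, hy, hlt⟩ := ContinuousLinearMap.exists_lt_apply_of_lt_opNorm _ h
  set b : EuclideanSpace ℝ (Fin m) := WithLp.toLp 2 (A.mulVec y) with hb
  have hlt' : K < ‖b‖ := hlt
  have hb0 : 0 < ‖b‖ := lt_of_le_of_lt hK hlt'
  refine ⟨‖b‖⁻¹ • b, y, ?_, hy.le, ?_⟩
  · rw [norm_smul, norm_inv, norm_norm, inv_mul_cancel₀ hb0.ne']
  · have : ∑ i, ∑ j, (‖b‖⁻¹ • b) i * A i j * y j = ‖b‖⁻¹ * ∑ i, b i ^ 2 := by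
      rw [Finset.mul_sum]
      refine Finset.sum_congr rfl fun i _ => ?_
      have : b i = ∑ j, A i j * y j := rfl
      simp only [PiLp.smul_apply, smul_eq_mul, mul_assoc]
      rw [← Finset.mul_sum, ← Finset.mul_sum, ← this, sq]
    rw [this, ← EuclideanSpace.real_norm_sq_eq, sq, inv_mul_cancel_left₀ hb0.ne']
    exact hlt'.le

lemma vol_ball_two (n : ℕ) : volume (Metric.ball (0 : EuclideanSpace ℝ (Fin n)) 2)
    = ENNReal.ofReal (2 ^ n) * volume (Metric.ball (0 : EuclideanSpace ℝ (Fin n)) 1) := by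
  rw [Measure.addHaar_ball_of_pos _ _ (by norm_num)]
  simp

lemma op_block {m n w : ℕ} (s2 : NNReal) (hs : (s2 : ℝ) * w = 1) (e : Fin m → Fin n → κ)
    (he : ∀ i j i' j', e i j = e i' j' → i = i' ∧ j = j') (K : ℝ) (hK : 0 ≤ K) :
    (Measure.pi fun _ : κ => gaussianReal 0 s2)
      {θ | K < ‖(Matrix.of fun i j => θ (e i j) : Matrix (Fin m) (Fin n) ℝ)‖}
      ≤ ENNReal.ofReal (2 ^ (m + n) * Real.exp (w * (8 - K))) := by
  set μ := (Measure.pi fun _ : κ => gaussianReal 0 s2) with hμ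
  set G : (κ → ℝ) → EuclideanSpace ℝ (Fin m) → EuclideanSpace ℝ (Fin n) → ℝ := fun θ x y => w * ∑ i, ∑ j, x i * θ (e i j) * y j with hG
  set bm := Metric.ball (0 : EuclideanSpace ℝ (Fin m)) 1
  set bn := Metric.ball (0 : EuclideanSpace ℝ (Fin n)) 1
  set Bm := Metric.ball (0 : EuclideanSpace ℝ (Fin m)) 2
  set Bn := Metric.ball (0 : EuclideanSpace ℝ (Fin n)) 2
  set F : (κ → ℝ) → ENNReal := fun θ =>
    ∫⁻ x in Bm, ∫⁻ y in Bn, ENNReal.ofReal (Real.exp (G θ x y)) with hF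
  have hGm : Measurable (fun p : ((κ → ℝ) × EuclideanSpace ℝ (Fin m)) × EuclideanSpace ℝ (Fin n) => ENNReal.ofReal (Real.exp (G p.1.1 p.1.2 p.2))) := by
    simp only [hG]; fun_prop
  have hFm1 : Measurable (fun p : (κ → ℝ) × EuclideanSpace ℝ (Fin m) => ∫⁻ y in Bn, ENNReal.ofReal (Real.exp (G p.1 p.2 y))) :=
    Measurable.lintegral_prod_right' (f := fun p : ((κ → ℝ) × EuclideanSpace ℝ (Fin m)) × EuclideanSpace ℝ (Fin n) => ENNReal.ofReal (Real.exp (G p.1.1 p.1.2 p.2))) hGm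
  have hFm : Measurable F :=
    Measurable.lintegral_prod_right' (f := fun p : (κ → ℝ) × EuclideanSpace ℝ (Fin m) => ∫⁻ y in Bn, ENNReal.ofReal (Real.exp (G p.1 p.2 y))) hFm1
  have hvm0 : volume bm ≠ 0 := (Metric.measure_ball_pos _ _ one_pos).ne'
  have hvn0 : volume bn ≠ 0 := (Metric.measure_ball_pos _ _ one_pos).ne'
  have hvm1 : volume bm ≠ ⊤ := measure_ball_lt_top.ne
  have hvn1 : volume bn ≠ ⊤ := measure_ball_lt_top.ne
  -- lower bound on `F`
  have hlow : ∀ θ, K < ‖(Matrix.of fun i j => θ (e i j) : Matrix (Fin m) (Fin n) ℝ)‖ →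
      ENNReal.ofReal (Real.exp (w * K)) * volume bm * volume bn ≤ F θ := by
    intro θ hθ
    obtain ⟨u, v, hu, hv, huv⟩ := exists_bilin_of_lt_norm _ K hK hθ
    have h1 : ENNReal.ofReal (Real.exp (G θ u v)) * volume bm
        ≤ ∫⁻ x in Bm, ENNReal.ofReal (Real.exp (G θ x v)) := by
      refine ball_average (fun x => G θ x v) ?_ ?_ ?_ u hu
      · simp only [hG]; fun_prop
      · intro x y
        simp only [hG, PiLp.add_apply, add_mul, Finset.sum_add_distrib, mul_add]
      · intro x
        simp only [hG, PiLp.neg_apply, neg_mul, Finset.sum_neg_distrib, mul_neg]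
    have h2 : ∀ x, ENNReal.ofReal (Real.exp (G θ x v)) * volume bn
        ≤ ∫⁻ y in Bn, ENNReal.ofReal (Real.exp (G θ x y)) := by
      intro x
      refine ball_average (fun y => G θ x y) ?_ ?_ ?_ v hv
      · simp only [hG]; fun_prop
      · intro x y
        simp only [hG, PiLp.add_apply, Finset.sum_add_distrib, mul_add]
      · intro x
        simp only [hG, PiLp.neg_apply, Finset.sum_neg_distrib, mul_neg]
    calc ENNReal.ofReal (Real.exp (w * K)) * volume bm * volume bn
        ≤ ENNReal.ofReal (Real.exp (G θ u v)) * volume bm * volume bn := by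
          gcongr
          simp only [hG]
          exact mul_le_mul_of_nonneg_left huv (by positivity)
      _ ≤ (∫⁻ x in Bm, ENNReal.ofReal (Real.exp (G θ x v))) * volume bn := by gcongr
      _ = ∫⁻ x in Bm, ENNReal.ofReal (Real.exp (G θ x v)) * volume bn := by
          rw [lintegral_mul_const]
          simp only [hG]; fun_prop
      _ ≤ F θ := lintegral_mono h2
  -- expectation
  have hexp : ∫⁻ θ, F θ ∂μ ≤ ENNReal.ofReal (Real.exp (8 * w)) * volume Bm * volume Bn := by
    have hpt : ∀ x ∈ Bm, ∀ y ∈ Bn, ∫⁻ θ, ENNReal.ofReal (Real.exp (G θ x y)) ∂μ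
        ≤ ENNReal.ofReal (Real.exp (8 * w)) := by
      intro x hx y hy
      set ee : Fin m × Fin n → κ := fun p => e p.1 p.2
      have hee : Function.Injective ee := fun p p' h => Prod.ext (he _ _ _ _ h).1 (he _ _ _ _ h).2
      have h1 : ∀ θ, G θ x y = ∑ k, coef ee (fun p => w * x p.1 * y p.2) k * θ k := by
        intro θ
        rw [coef_sum, Fintype.sum_prod_type]
        simp only [hG, Finset.mul_sum]
        refine Finset.sum_congr rfl fun i _ => Finset.sum_congr rfl fun j _ => ?_
        simp only [ee]; ring
      simp_rw [h1]
      rw [hμ, mgf_pi, coef_sq ee hee, Fintype.sum_prod_type]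
      apply ENNReal.ofReal_le_ofReal
      apply Real.exp_le_exp.mpr
      have h2 : ∑ i, ∑ j, ((w : ℝ) * x i * y j) ^ 2 = w * w * (‖x‖ ^ 2 * ‖y‖ ^ 2) := by
        rw [EuclideanSpace.real_norm_sq_eq, EuclideanSpace.real_norm_sq_eq, Finset.sum_mul_sum]
        simp only [Finset.mul_sum]
        refine Finset.sum_congr rfl fun i _ => Finset.sum_congr rfl fun j _ => by ring
      simp only [h2]
      rw [show (s2 : ℝ) * (w * w * (‖x‖ ^ 2 * ‖y‖ ^ 2)) = (s2 * w) * (w * (‖x‖ ^ 2 * ‖y‖ ^ 2)) by ring, hs]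
      have hx' : ‖x‖ < 2 := by simpa [Bm] using hx
      have hy' : ‖y‖ < 2 := by simpa [Bn] using hy
      have hx2 : ‖x‖ ^ 2 ≤ 4 := by nlinarith [norm_nonneg x]
      have hy2 : ‖y‖ ^ 2 ≤ 4 := by nlinarith [norm_nonneg y]
      have : ‖x‖ ^ 2 * ‖y‖ ^ 2 ≤ 4 * 4 := mul_le_mul hx2 hy2 (by positivity) (by norm_num)
      have hw : (0 : ℝ) ≤ w := by positivity
      nlinarith
    simp only [hF]
    rw [lintegral_lintegral_swap hFm1.aemeasurable]
    have h3 : ∀ x, ∫⁻ θ, (∫⁻ y in Bn, ENNReal.ofReal (Real.exp (G θ x y))) ∂μ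
        = ∫⁻ y in Bn, (∫⁻ θ, ENNReal.ofReal (Real.exp (G θ x y)) ∂μ) := by
      intro x
      rw [lintegral_lintegral_swap]
      apply Measurable.aemeasurable
      simp only [Function.uncurry_def, hG]; fun_prop
    simp_rw [h3]
    calc _ ≤ ∫⁻ x in Bm, ∫⁻ y in Bn, ENNReal.ofReal (Real.exp (8 * w)) := by
          refine setLIntegral_mono' measurableSet_ball fun x hx => ?_
          exact setLIntegral_mono' measurableSet_ball fun y hy => hpt x hx y hy
      _ = _ := by
          simp only [lintegral_const, Measure.restrict_apply MeasurableSet.univ, Set.univ_inter]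
          ring
  set T := ENNReal.ofReal (Real.exp (w * K)) * volume bm * volume bn with hT
  have hT0 : T ≠ 0 := by
    rw [hT]; refine mul_ne_zero (mul_ne_zero ?_ hvm0) hvn0
    simp [Real.exp_pos]
  have hT1 : T ≠ ⊤ := ENNReal.mul_ne_top (ENNReal.mul_ne_top ENNReal.ofReal_ne_top hvm1) hvn1
  refine (measure_mono (t := {θ | T ≤ F θ}) fun θ hθ => hlow θ hθ).trans ?_
  refine (meas_ge_le_lintegral_div hFm.aemeasurable hT0 hT1).trans ?_
  refine ENNReal.div_le_of_le_mul ?_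
  refine hexp.trans (le_of_eq ?_)
  rw [show volume Bm = _ from vol_ball_two m, show volume Bn = _ from vol_ball_two n, hT]
  have : ENNReal.ofReal (2 ^ (m + n) * Real.exp (w * (8 - K))) * ENNReal.ofReal (Real.exp (w * K))
      = ENNReal.ofReal (Real.exp (8 * w)) * ENNReal.ofReal (2 ^ m) * ENNReal.ofReal (2 ^ n) := by
    rw [← ENNReal.ofReal_mul (by positivity), ← ENNReal.ofReal_mul (by positivity),
      ← ENNReal.ofReal_mul (by positivity)]
    congr 1
    rw [mul_assoc, ← Real.exp_add, pow_add]
    ring_nf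
  calc _ = (ENNReal.ofReal (Real.exp (8 * w)) * ENNReal.ofReal (2 ^ m) * ENNReal.ofReal (2 ^ n))
        * volume bm * volume bn := by ring
    _ = _ := by rw [← this]; ring

end opnorm
end DLNAux

namespace DLNAux
section det
open scoped Matrix.Norms.L2Operator

/-- hidden matrices, extended by the identity -/
def Wm (θ : DLNParams n0 nL w L) (k : ℕ) : Matrix (Fin w) (Fin w) ℝ :=
  if h : k < L - 2 then dlnWmid θ ⟨k, h⟩ else 1

/-- partial products of hidden matrices -/
def Q (θ : DLNParams n0 nL w L) : ℕ → Matrix (Fin w) (Fin w) ℝ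
  | 0 => 1
  | k + 1 => Wm θ k * Q θ k

lemma Q_eq (θ : DLNParams n0 nL w L) (k : ℕ) :
    Q θ k = ((List.range k).map (Wm θ)).reverse.prod := by
  induction k with
  | zero => simp [Q]
  | succ k ih => simp [Q, ih, List.range_succ]

lemma mid_prod (θ : DLNParams n0 nL w L) :
    (List.ofFn (dlnWmid θ)).reverse.prod = Q θ (L - 2) := by
  rw [Q_eq]
  congr 2
  apply List.ext_getElem
  · simp
  · intro i h1 h2
    simp at h1
    simp [Wm, h1]

/-- everything but the last layer -/
def Bm (θ : DLNParams n0 nL w L) : Matrix (Fin w) (Fin n0) ℝ := Q θ (L - 2) * dlnW1 θ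

lemma dlnMatrix_eq (θ : DLNParams n0 nL w L) (i : Fin nL) (j : Fin n0) :
    dlnMatrix θ i j = (dlnWL θ * Bm θ) i j := by
  unfold dlnMatrix Bm
  rw [mid_prod, Matrix.mul_assoc]

lemma col_sq_le {m n : ℕ} (A : Matrix (Fin m) (Fin n) ℝ) (j : Fin n) :
    ∑ i, A i j ^ 2 ≤ ‖A‖ ^ 2 := by
  have h := Matrix.l2_opNorm_mulVec A (EuclideanSpace.single j (1 : ℝ))
  rw [EuclideanSpace.norm_single, norm_one, mul_one] at h
  have h2 := pow_le_pow_left₀ (norm_nonneg _) h 2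
  rw [EuclideanSpace.real_norm_sq_eq] at h2
  simpa using h2

lemma row_sq_le {m n : ℕ} (A : Matrix (Fin m) (Fin n) ℝ) (i : Fin m) :
    ∑ j, A i j ^ 2 ≤ ‖A‖ ^ 2 := by
  have h := col_sq_le A.conjTranspose i
  rw [Matrix.l2_opNorm_conjTranspose] at h
  simpa using h

lemma entry_le {m n : ℕ} (A : Matrix (Fin m) (Fin n) ℝ) (i : Fin m) (j : Fin n) :
    |A i j| ≤ ‖A‖ := by
  apply abs_le_of_sq_le_sq _ (norm_nonneg _)
  refine le_trans ?_ (col_sq_le A j)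
  exact Finset.single_le_sum (f := fun i => A i j ^ 2) (fun _ _ => sq_nonneg _) (Finset.mem_univ i)

lemma norm_le_frob {m n : ℕ} (A : Matrix (Fin m) (Fin n) ℝ) :
    ‖A‖ ≤ Real.sqrt (∑ i, ∑ j, A i j ^ 2) := by
  rw [Matrix.l2_opNorm_def]
  refine ContinuousLinearMap.opNorm_le_bound _ (Real.sqrt_nonneg _) fun y => ?_
  change ‖(WithLp.toLp 2 (A.mulVec y) : EuclideanSpace ℝ (Fin m))‖ ≤ _
  have hS : 0 ≤ ∑ i, ∑ j, A i j ^ 2 := Finset.sum_nonneg fun _ _ => Finset.sum_nonneg fun _ _ => sq_nonneg _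
  refine abs_le_of_sq_le_sq' ?_ (by positivity) |>.2
  rw [mul_pow, Real.sq_sqrt hS, EuclideanSpace.real_norm_sq_eq, EuclideanSpace.real_norm_sq_eq,
    Finset.sum_mul]
  refine Finset.sum_le_sum fun i _ => ?_
  exact Finset.sum_mul_sq_le_sq_mul_sq Finset.univ (fun j => A i j) (fun j => y j)

lemma sum_idx (f : DLNIdx n0 nL w L → ℝ) : ∑ i, f i =
    (∑ i, ∑ j, f (Sum.inl (i, j))) + ((∑ l, ∑ i, ∑ j, f (Sum.inr (Sum.inl (l, i, j)))) +
      ∑ i, ∑ j, f (Sum.inr (Sum.inr (i, j)))) := by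
  simp [Fintype.sum_sum_type, Fintype.sum_prod_type]

lemma norm_W1_sub (θ θ' : DLNParams n0 nL w L) : ‖dlnW1 θ' - dlnW1 θ‖ ≤ dlnDist θ θ' := by
  refine (norm_le_frob _).trans ?_
  unfold dlnDist
  apply Real.sqrt_le_sqrt
  rw [sum_idx]
  have h1 : ∀ i j, (dlnW1 θ' - dlnW1 θ) i j ^ 2 = (θ (Sum.inl (i, j)) - θ' (Sum.inl (i, j))) ^ 2 := by
    intro i j; simp [dlnW1]; ring
  simp only [h1]
  refine le_add_of_nonneg_right ?_
  positivity

lemma norm_WL_sub (θ θ' : DLNParams n0 nL w L) : ‖dlnWL θ' - dlnWL θ‖ ≤ dlnDist θ θ' := by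
  refine (norm_le_frob _).trans ?_
  unfold dlnDist
  apply Real.sqrt_le_sqrt
  rw [sum_idx, ← add_assoc]
  have h1 : ∀ i j, (dlnWL θ' - dlnWL θ) i j ^ 2
      = (θ (Sum.inr (Sum.inr (i, j))) - θ' (Sum.inr (Sum.inr (i, j)))) ^ 2 := by
    intro i j; simp [dlnWL]; ring
  simp only [h1]
  refine le_add_of_nonneg_left ?_
  positivity

lemma norm_Wm_sub (θ θ' : DLNParams n0 nL w L) (k : ℕ) : ‖Wm θ' k - Wm θ k‖ ≤ dlnDist θ θ' := by
  unfold Wm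
  split_ifs with h
  swap
  · simp [dlnDist]
  refine (norm_le_frob _).trans ?_
  unfold dlnDist
  apply Real.sqrt_le_sqrt
  rw [sum_idx]
  have h1 : ∀ i j, (dlnWmid θ' ⟨k, h⟩ - dlnWmid θ ⟨k, h⟩) i j ^ 2
      = (θ (Sum.inr (Sum.inl (⟨k, h⟩, i, j))) - θ' (Sum.inr (Sum.inl (⟨k, h⟩, i, j)))) ^ 2 := by
    intro i j; simp [dlnWmid]; ring
  simp only [h1]
  have h2 := Finset.single_le_sum (f := fun l : Fin (L - 2) => ∑ i : Fin w, ∑ j : Fin w,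
    (θ (Sum.inr (Sum.inl (l, i, j))) - θ' (Sum.inr (Sum.inl (l, i, j)))) ^ 2)
    (fun _ _ => by positivity) (Finset.mem_univ ⟨k, h⟩)
  have h3 : 0 ≤ ∑ i, ∑ j, (θ (Sum.inl (i, j)) - θ' (Sum.inl (i, j))) ^ 2 := by positivity
  have h4 : 0 ≤ ∑ i, ∑ j, (θ (Sum.inr (Sum.inr (i, j))) - θ' (Sum.inr (Sum.inr (i, j)))) ^ 2 := by
    positivity
  linarith

lemma norm_one_le' (w : ℕ) : ‖(1 : Matrix (Fin w) (Fin w) ℝ)‖ ≤ 1 := by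
  rw [← Matrix.diagonal_one, Matrix.l2_opNorm_diagonal]
  refine (pi_norm_le_iff_of_nonneg zero_le_one).2 fun i => by simp

/-- all weight matrices have bounded operator norm -/
def Good (K : ℝ) (θ : DLNParams n0 nL w L) : Prop :=
  ‖dlnW1 θ‖ ≤ K ∧ ‖dlnWL θ‖ ≤ K ∧ ∀ l, ‖dlnWmid θ l‖ ≤ K

lemma Good.Wm {K : ℝ} (hK : 1 ≤ K) {θ : DLNParams n0 nL w L} (h : Good K θ) (k : ℕ) :
    ‖Wm θ k‖ ≤ K := by
  unfold DLNAux.Wm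
  split_ifs
  · exact h.2.2 _
  · exact (norm_one_le' w).trans hK

lemma Good.Q {K : ℝ} (hK : 1 ≤ K) {θ : DLNParams n0 nL w L} (h : Good K θ) (k : ℕ) :
    ‖Q θ k‖ ≤ K ^ k := by
  induction k with
  | zero => simpa [DLNAux.Q] using norm_one_le' w
  | succ k ih =>
    rw [DLNAux.Q, pow_succ']
    exact (Matrix.l2_opNorm_mul _ _).trans
      (mul_le_mul (h.Wm hK k) ih (norm_nonneg _) (by linarith))

lemma mul_sub_bound {l m n : ℕ} (A A' : Matrix (Fin l) (Fin m) ℝ) (B B' : Matrix (Fin m) (Fin n) ℝ)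
    {a b α β : ℝ} (hA : ‖A' - A‖ ≤ α) (hB : ‖B' - B‖ ≤ β) (hA' : ‖A'‖ ≤ a) (hB' : ‖B‖ ≤ b) :
    ‖A' * B' - A * B‖ ≤ a * β + α * b := by
  have : A' * B' - A * B = A' * (B' - B) + (A' - A) * B := by
    rw [Matrix.mul_sub, Matrix.sub_mul]; abel
  rw [this]
  have ha : 0 ≤ a := (norm_nonneg _).trans hA'
  have hα : 0 ≤ α := (norm_nonneg _).trans hA
  refine (norm_add_le _ _).trans (add_le_add ?_ ?_)
  · exact (Matrix.l2_opNorm_mul _ _).trans (mul_le_mul hA' hB (norm_nonneg _) ha)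
  · exact (Matrix.l2_opNorm_mul _ _).trans (mul_le_mul hA hB' (norm_nonneg _) hα)

lemma Q_sub {K r : ℝ} (hK : 1 ≤ K) (hr : r ≤ 1) {θ θ' : DLNParams n0 nL w L} (h : Good K θ)
    (hd : dlnDist θ θ' ≤ r) (k : ℕ) : ‖Q θ' k - Q θ k‖ ≤ k * (K + 1) ^ k * r := by
  have hr0 : 0 ≤ r := (Real.sqrt_nonneg _).trans hd
  induction k with
  | zero => simp [Q]
  | succ k ih =>
    have h1 : ‖Wm θ' k - Wm θ k‖ ≤ r := (norm_Wm_sub _ _ _).trans hd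
    have h2 : ‖Wm θ' k‖ ≤ K + 1 := by
      have := norm_sub_norm_le (Wm θ' k) (Wm θ k)
      have := h.Wm hK k
      linarith
    have h3 : ‖Q θ k‖ ≤ (K + 1) ^ k :=
      (h.Q hK k).trans (pow_le_pow_left₀ (by linarith) (by linarith) k)
    refine (mul_sub_bound _ _ _ _ h1 ih h2 h3).trans ?_
    have h4 : 1 * ((K + 1) ^ k * r) ≤ (K + 1) * ((K + 1) ^ k * r) := by
      apply mul_le_mul_of_nonneg_right (by linarith)
      have : 0 ≤ K + 1 := by linarith
      positivity
    push_cast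
    rw [pow_succ]
    nlinarith

lemma Good.Bm {K : ℝ} (hK : 1 ≤ K) {θ : DLNParams n0 nL w L} (h : Good K θ) :
    ‖Bm θ‖ ≤ K ^ (L - 2) * K :=
  (Matrix.l2_opNorm_mul _ _).trans
      (mul_le_mul (h.Q hK _) h.1 (norm_nonneg _) (by positivity))

/-- perturbation bound, with a constant depending on `L`, `K` only -/
lemma exists_pert (L : ℕ) (K : ℝ) (hK : 1 ≤ K) : ∃ P : ℝ, 0 < P ∧ ∀ (n0 nL w : ℕ) (r : ℝ) (_ : r ≤ 1)
    (θ θ' : DLNParams n0 nL w L) (_ : Good K θ) (_ : dlnDist θ θ' ≤ r),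
    ‖Bm θ' - Bm θ‖ ≤ P * r ∧ ∀ i j, |dlnMatrix θ' i j - dlnMatrix θ i j| ≤ P * r := by
  set P0 : ℝ := (L - 2 : ℕ) * (K + 1) ^ (L - 2) with hP0
  have hP00 : 0 ≤ P0 := by have : 0 ≤ K + 1 := by linarith
                           positivity
  set P1 : ℝ := (K ^ (L - 2) + P0) + P0 * K with hP1
  have hP10 : 0 < P1 := by positivity
  refine ⟨P1 + (K + 1) * P1 + K ^ (L - 2) * K, by positivity, fun n0 nL w r hr θ θ' h hd => ?_⟩
  have hr0 : 0 ≤ r := (Real.sqrt_nonneg _).trans hd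
  have hQ := Q_sub hK hr h hd (L - 2)
  rw [← hP0] at hQ
  have h1 : ‖dlnW1 θ' - dlnW1 θ‖ ≤ r := (norm_W1_sub _ _).trans hd
  have h2 : ‖dlnWL θ' - dlnWL θ‖ ≤ r := (norm_WL_sub _ _).trans hd
  have hQ' : ‖Q θ' (L - 2)‖ ≤ K ^ (L - 2) + P0 := by
    have := norm_sub_norm_le (Q θ' (L - 2)) (Q θ (L - 2))
    have := h.Q hK (L - 2)
    nlinarith
  have hL' : ‖dlnWL θ'‖ ≤ K + 1 := by
    have := norm_sub_norm_le (dlnWL θ') (dlnWL θ)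
    have := h.2.1
    linarith
  have hB : ‖Bm θ' - Bm θ‖ ≤ P1 * r := by
    refine (mul_sub_bound _ _ _ _ hQ h1 hQ' h.1).trans (le_of_eq ?_)
    rw [hP1]; ring
  have hA : ‖dlnWL θ' * Bm θ' - dlnWL θ * Bm θ‖ ≤ (K + 1) * (P1 * r) + r * (K ^ (L - 2) * K) :=
    mul_sub_bound _ _ _ _ h2 hB hL' (h.Bm hK)
  have e1 : 0 ≤ P1 * r := by positivity
  have e2 : 0 ≤ (K + 1) * (P1 * r) := by have : 0 ≤ K + 1 := by linarith
                                         positivity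
  have e3 : 0 ≤ r * (K ^ (L - 2) * K) := by positivity
  constructor
  · refine hB.trans ?_
    linarith
  · intro i j
    rw [dlnMatrix_eq, dlnMatrix_eq, ← Matrix.sub_apply]
    refine (entry_le _ i j).trans (hA.trans ?_)
    linarith

end det
end DLNAux

namespace DLNAux
section tw
open scoped Matrix.Norms.L2Operator

lemma diff_Wm (k : ℕ) (i j : Fin w) :
    Differentiable ℝ (fun θ : DLNParams n0 nL w L => Wm θ k i j) := by
  unfold Wm dlnWmid
  split_ifs with h
  · simp only [Matrix.of_apply]; fun_prop
  · fun_prop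

lemma diff_Q (k : ℕ) : ∀ (i j : Fin w),
    Differentiable ℝ (fun θ : DLNParams n0 nL w L => Q θ k i j) := by
  induction k with
  | zero => intro i j; simp only [Q]; fun_prop
  | succ k ih =>
    intro i j
    simp only [Q, Matrix.mul_apply]
    refine Differentiable.fun_sum fun l _ => ?_
    exact (diff_Wm k i l).mul (ih l j)

lemma diff_Bm (i : Fin w) (j : Fin n0) :
    Differentiable ℝ (fun θ : DLNParams n0 nL w L => Bm θ i j) := by
  simp only [Bm, Matrix.mul_apply]
  refine Differentiable.fun_sum fun l _ => ?_
  refine (diff_Q _ i l).mul ?_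
  simp only [dlnW1, Matrix.of_apply]; fun_prop

lemma diff_dlnMatrix : Differentiable ℝ (fun θ : DLNParams n0 nL w L => dlnMatrix θ) := by
  rw [differentiable_pi]
  intro i
  rw [differentiable_pi]
  intro j
  simp only [dlnMatrix_eq, Matrix.mul_apply]
  refine Differentiable.fun_sum fun l _ => ?_
  refine Differentiable.mul ?_ (diff_Bm l j)
  simp only [dlnWL, Matrix.of_apply]; fun_prop

/-- the modified parameters -/
def tweak (θ : DLNParams n0 nL w L) (a : ℝ) (D : Fin nL → Fin n0 → ℝ) : DLNParams n0 nL w L :=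
  Sum.elim (fun p => if p.1.val = p.2.val then a else 0)
    (Sum.elim (fun p => if p.2.2.val < n0 then (if p.2.1 = p.2.2 then 1 else 0)
        else θ (Sum.inr (Sum.inl p)))
      (fun p => if h : p.2.val < n0 then D p.1 ⟨p.2.val, h⟩ else 0))

lemma tweak_Wm_mul (θ : DLNParams n0 nL w L) (a : ℝ) (D : Fin nL → Fin n0 → ℝ) (k : ℕ) :
    Wm (tweak θ a D) k * dlnW1 (tweak θ a D) = dlnW1 (tweak θ a D) := by
  unfold Wm
  split_ifs with h
  swap
  · simp
  ext i j
  rw [Matrix.mul_apply]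
  rw [Finset.sum_eq_single i]
  · simp only [dlnWmid, dlnW1, tweak, Matrix.of_apply, Sum.elim_inl, Sum.elim_inr]
    by_cases hij : i.val = j.val
    · have : i.val < n0 := by rw [hij]; exact j.2
      simp [hij]
    · simp [hij]
  · intro l _ hl
    simp only [dlnWmid, dlnW1, tweak, Matrix.of_apply, Sum.elim_inl, Sum.elim_inr]
    by_cases hij : l.val = j.val
    · have : l.val < n0 := by rw [hij]; exact j.2
      simp [this, hl.symm]
    · simp [hij]
  · simp

lemma tweak_Bm (θ : DLNParams n0 nL w L) (a : ℝ) (D : Fin nL → Fin n0 → ℝ) :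
    Bm (tweak θ a D) = dlnW1 (tweak θ a D) := by
  unfold Bm
  generalize L - 2 = k
  induction k with
  | zero => simp [Q]
  | succ k ih => rw [Q, Matrix.mul_assoc, ih, tweak_Wm_mul]

lemma tweak_matrix (hw : n0 ≤ w) (θ : DLNParams n0 nL w L) (a : ℝ) (D : Fin nL → Fin n0 → ℝ) :
    dlnMatrix (tweak θ a D) = a • D := by
  ext i j
  rw [dlnMatrix_eq, tweak_Bm, Matrix.mul_apply]
  rw [Finset.sum_eq_single ⟨j.val, by omega⟩]
  · simp [dlnWL, dlnW1, tweak, mul_comm]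
  · intro l _ hl
    have : l.val ≠ j.val := fun h => hl (Fin.ext h)
    simp [dlnWL, dlnW1, tweak, this]
  · simp

lemma sum_ind_le (n m : ℕ) (j : Fin n) (a : ℝ) :
    ∑ i : Fin m, (if i.val = j.val then a else 0) ^ 2 ≤ a ^ 2 := by
  by_cases h : j.val < m
  · rw [Finset.sum_eq_single ⟨j.val, h⟩]
    · simp
    · intro l _ hl
      have : l.val ≠ j.val := fun h => hl (Fin.ext h)
      simp [this]
    · simp
  · refine (Finset.sum_eq_zero fun i _ => ?_).trans_le (sq_nonneg a)
    have : i.val ≠ j.val := by omega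
    simp [this]

lemma tweak_dist {K : ℝ} (hw : n0 ≤ w) {θ : DLNParams n0 nL w L} (h : Good K θ) (a : ℝ)
    (D : Fin nL → Fin n0 → ℝ) :
    dlnDist θ (tweak θ a D) ≤ Real.sqrt (n0 * (2 * K ^ 2 + 2 * a ^ 2) +
      ((L - 2 : ℕ) * (n0 * (2 * K ^ 2 + 2)) + (nL * (2 * K ^ 2) + 2 * ∑ i, ∑ j, D i j ^ 2))) := by
  have hsq : ∀ x y : ℝ, (x - y) ^ 2 ≤ 2 * x ^ 2 + 2 * y ^ 2 := fun x y => by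
    nlinarith [sq_nonneg (x + y)]
  have hle : ∀ x : ℝ, 0 ≤ x → x ≤ K → x ^ 2 ≤ K ^ 2 := fun x h0 h1 => pow_le_pow_left₀ h0 h1 2
  unfold dlnDist
  apply Real.sqrt_le_sqrt
  rw [sum_idx]
  refine add_le_add ?_ (add_le_add ?_ ?_)
  · rw [Finset.sum_comm]
    have : ∀ j : Fin n0, ∑ i : Fin w, (θ (Sum.inl (i, j)) - tweak θ a D (Sum.inl (i, j))) ^ 2
        ≤ 2 * K ^ 2 + 2 * a ^ 2 := by
      intro j
      calc _ ≤ ∑ i : Fin w, (2 * θ (Sum.inl (i, j)) ^ 2 + 2 * (tweak θ a D (Sum.inl (i, j))) ^ 2) :=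
            Finset.sum_le_sum fun i _ => hsq _ _
        _ = 2 * ∑ i : Fin w, dlnW1 θ i j ^ 2 + 2 * ∑ i : Fin w, (if i.val = j.val then a else 0) ^ 2 := by
            rw [Finset.sum_add_distrib, Finset.mul_sum, Finset.mul_sum]
            rfl
        _ ≤ _ := by
            have h1 := (col_sq_le (dlnW1 θ) j).trans (hle _ (norm_nonneg _) h.1)
            have h2 := sum_ind_le n0 w j a
            linarith
    refine (Finset.sum_le_sum fun j _ => this j).trans (le_of_eq ?_)
    rw [Finset.sum_const, Finset.card_univ, Fintype.card_fin, nsmul_eq_mul]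
  · have : ∀ l : Fin (L - 2), ∑ i : Fin w, ∑ j : Fin w, (θ (Sum.inr (Sum.inl (l, i, j)))
        - tweak θ a D (Sum.inr (Sum.inl (l, i, j)))) ^ 2 ≤ n0 * (2 * K ^ 2 + 2) := by
      intro l
      rw [Finset.sum_comm]
      have hj : ∀ j : Fin w, ∑ i : Fin w, (θ (Sum.inr (Sum.inl (l, i, j)))
        - tweak θ a D (Sum.inr (Sum.inl (l, i, j)))) ^ 2 ≤ if j.val < n0 then 2 * K ^ 2 + 2 else 0 := by
        intro j
        split_ifs with hj
        · calc _ ≤ ∑ i : Fin w, (2 * θ (Sum.inr (Sum.inl (l, i, j))) ^ 2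
                + 2 * (tweak θ a D (Sum.inr (Sum.inl (l, i, j)))) ^ 2) :=
                Finset.sum_le_sum fun i _ => hsq _ _
            _ = 2 * ∑ i : Fin w, dlnWmid θ l i j ^ 2
                + 2 * ∑ i : Fin w, (if i.val = j.val then (1 : ℝ) else 0) ^ 2 := by
                rw [Finset.sum_add_distrib, Finset.mul_sum, Finset.mul_sum]
                simp [tweak, hj, dlnWmid, Fin.ext_iff]
            _ ≤ _ := by
                have h1 := (col_sq_le (dlnWmid θ l) j).trans (hle _ (norm_nonneg _) (h.2.2 l))
                have h2 := sum_ind_le w w j 1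
                linarith
        · simp [tweak, hj]
      refine (Finset.sum_le_sum fun j _ => hj j).trans ?_
      rw [Finset.sum_ite, Finset.sum_const_zero, add_zero, Finset.sum_const, nsmul_eq_mul]
      refine mul_le_mul_of_nonneg_right ?_ (by positivity)
      have : (Finset.univ.filter fun j : Fin w => j.val < n0).card ≤ n0 := by
        calc _ = ((Finset.univ.filter fun j : Fin w => j.val < n0).image Fin.val).card := by
              rw [Finset.card_image_of_injective _ Fin.val_injective]
          _ ≤ (Finset.range n0).card := by
              apply Finset.card_le_card
              intro x hx
              simp only [Finset.mem_image, Finset.mem_filter, Finset.mem_univ, true_and] at hx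
              obtain ⟨y, hy, rfl⟩ := hx
              simpa using hy
          _ = n0 := by simp
      exact_mod_cast this
    refine (Finset.sum_le_sum fun l _ => this l).trans (le_of_eq ?_)
    simp
  · calc _ ≤ ∑ i : Fin nL, ∑ k : Fin w, (2 * θ (Sum.inr (Sum.inr (i, k))) ^ 2
            + 2 * (tweak θ a D (Sum.inr (Sum.inr (i, k)))) ^ 2) :=
          Finset.sum_le_sum fun i _ => Finset.sum_le_sum fun k _ => hsq _ _
      _ = ∑ i : Fin nL, 2 * ∑ k : Fin w, dlnWL θ i k ^ 2 + ∑ i : Fin nL, 2 * ∑ k : Fin w,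
            (tweak θ a D (Sum.inr (Sum.inr (i, k)))) ^ 2 := by
          simp only [Finset.sum_add_distrib, Finset.mul_sum]
          rfl
      _ ≤ _ := by
          refine add_le_add ?_ ?_
          · calc _ ≤ ∑ i : Fin nL, 2 * K ^ 2 := Finset.sum_le_sum fun i _ => by
                  have h1 := (row_sq_le (dlnWL θ) i).trans (hle _ (norm_nonneg _) h.2.1)
                  linarith
              _ = _ := by simp
          · rw [← Finset.mul_sum]
            refine mul_le_mul_of_nonneg_left (Finset.sum_le_sum fun i _ => le_of_eq ?_) (by norm_num)
            symm
            refine Finset.sum_of_injOn (fun j : Fin n0 => (⟨j.val, by omega⟩ : Fin w)) ?_ ?_ ?_ ?_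
            · intro x _ y _ hxy
              simpa [Fin.ext_iff] using hxy
            · intro x _; simp
            · intro k _ hk
              have : ¬ k.val < n0 := fun hlt => hk ⟨⟨k.val, hlt⟩, by simp, by simp⟩
              simp [tweak, this]
            · intro j _
              simp [tweak]

lemma tweak_saddle (hw : n0 ≤ w) {C : (Fin nL → Fin n0 → ℝ) → ℝ}
    (hconv : ConvexOn ℝ Set.univ C) (hdiff : Differentiable ℝ C)
    {B : Fin nL → Fin n0 → ℝ} (hB : C B < C 0) (θ : DLNParams n0 nL w L) :
    DLNIsSaddle C (tweak θ 0 0) := by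
  set τ := tweak θ 0 0 with hτ
  have hA : dlnMatrix τ = 0 := by rw [hτ, tweak_matrix hw]; simp
  have hW1 : dlnW1 τ = 0 := by ext i j; simp [hτ, dlnW1, tweak]
  have hWL : dlnWL τ = 0 := by ext i j; simp [hτ, dlnWL, tweak]
  constructor
  · have hD : fderiv ℝ (fun θ : DLNParams n0 nL w L => dlnMatrix θ) τ = 0 := by
      ext η i j
      have h1 : HasFDerivAt (fun θ : DLNParams n0 nL w L => dlnMatrix θ)
        (fderiv ℝ (fun θ : DLNParams n0 nL w L => dlnMatrix θ) τ) (τ + (0 : ℝ) • η) := by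
        simpa using (diff_dlnMatrix τ).hasFDerivAt
      have hline : HasDerivAt (fun t : ℝ => τ + t • η) η 0 := by
        simpa using ((hasDerivAt_id (0 : ℝ)).smul_const η).const_add τ
      have h2 := h1.comp_hasDerivAt (0 : ℝ) hline
      have h3 := (hasDerivAt_pi.1 (hasDerivAt_pi.1 h2 i)) j
      have h4 : HasDerivAt (fun t : ℝ => t * (t * (dlnWL η * Q (τ + t • η) (L - 2) * dlnW1 η) i j)) 0 0 := by
        have hg : DifferentiableAt ℝ (fun t : ℝ => t * (dlnWL η * Q (τ + t • η) (L - 2) * dlnW1 η) i j) 0 := by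
          simp only [Matrix.mul_apply]
          refine differentiableAt_id.mul ?_
          refine DifferentiableAt.fun_sum fun l _ => ?_
          refine DifferentiableAt.mul ?_ (differentiableAt_const _)
          refine DifferentiableAt.fun_sum fun k _ => ?_
          refine DifferentiableAt.mul (differentiableAt_const _) ?_
          exact ((diff_Q (L - 2) k l).comp (g := fun θ : DLNParams n0 nL w L => Q θ (L - 2) k l)
            (f := fun t : ℝ => τ + t • η) (by fun_prop)) 0
        have := (hasDerivAt_id' (0 : ℝ)).fun_mul hg.hasDerivAt
        simpa using this
      have h5 : (fun t : ℝ => ((fun θ : DLNParams n0 nL w L => dlnMatrix θ) ∘ fun t : ℝ => τ + t • η) t i j)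
          = fun t : ℝ => t * (t * (dlnWL η * Q (τ + t • η) (L - 2) * dlnW1 η) i j) := by
        ext t
        have e1 : dlnWL (τ + t • η) = t • dlnWL η := by
          have : dlnWL (τ + t • η) = dlnWL τ + t • dlnWL η := by ext i j; simp [dlnWL]
          rw [this, hWL, zero_add]
        have e2 : dlnW1 (τ + t • η) = t • dlnW1 η := by
          have : dlnW1 (τ + t • η) = dlnW1 τ + t • dlnW1 η := by ext i j; simp [dlnW1]
          rw [this, hW1, zero_add]
        simp only [Function.comp]
        rw [dlnMatrix_eq, Bm, e1, e2]
        simp [Matrix.mul_assoc]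
      rw [h5] at h3
      simpa using h3.unique h4
    have : fderiv ℝ (dlnLoss C) τ
        = (fderiv ℝ C (dlnMatrix τ)).comp (fderiv ℝ (fun θ : DLNParams n0 nL w L => dlnMatrix θ) τ) :=
      fderiv_comp (g := C) (f := fun θ : DLNParams n0 nL w L => dlnMatrix θ) τ (hdiff _) (diff_dlnMatrix τ)
    rw [this, hD]; simp
  · intro hmin
    have hcont : Continuous (fun t : ℝ => tweak θ t (t • B)) := by
      refine continuous_pi fun k => ?_
      rcases k with p | p | p
      · simp only [tweak, Sum.elim_inl]; split_ifs <;> fun_prop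
      · simp only [tweak, Sum.elim_inl, Sum.elim_inr]; fun_prop
      · simp only [tweak, Sum.elim_inr]
        split_ifs <;> fun_prop
    have h0 : tweak θ (0 : ℝ) ((0 : ℝ) • B) = τ := by rw [zero_smul]
    have ht : Filter.Tendsto (fun t : ℝ => tweak θ t (t • B)) (nhdsWithin 0 (Set.Ioi 0)) (nhds τ) := by
      rw [← h0]; exact (hcont.tendsto 0).mono_left nhdsWithin_le_nhds
    have h1 := ht.eventually hmin
    have h2 : ∀ᶠ t : ℝ in nhdsWithin 0 (Set.Ioi 0), t ∈ Set.Ioo (0 : ℝ) 1 :=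
      Ioo_mem_nhdsGT one_pos
    obtain ⟨t, ht1, ht2, ht3⟩ := (h1.and h2).exists
    simp only [dlnLoss, hA, tweak_matrix hw] at ht1
    have hc := hconv.2 (Set.mem_univ (0 : Fin nL → Fin n0 → ℝ)) (Set.mem_univ B)
      (show (0 : ℝ) ≤ 1 - t * t by nlinarith) (show (0 : ℝ) ≤ t * t by positivity) (by ring)
    rw [smul_zero, zero_add, ← smul_smul] at hc
    simp only [smul_eq_mul] at hc
    have : 0 < t * t := by positivity
    nlinarith

lemma critical_last {C : (Fin nL → Fin n0 → ℝ) → ℝ} (hdiff : Differentiable ℝ C)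
    (θ : DLNParams n0 nL w L) (hθ : fderiv ℝ (dlnLoss C) θ = 0) (V : Matrix (Fin nL) (Fin w) ℝ) :
    fderiv ℝ C (dlnMatrix θ) (fun i j => (V * Bm θ) i j) = 0 := by
  set η : DLNParams n0 nL w L := Sum.elim 0 (Sum.elim 0 fun p => V p.1 p.2) with hη
  have hmat : ∀ t : ℝ, dlnMatrix (θ + t • η) = dlnMatrix θ + t • (fun i j => (V * Bm θ) i j) := by
    intro t
    have hQ : ∀ k, Q (θ + t • η) k = Q θ k := by
      intro k
      induction k with
      | zero => rfl
      | succ k ih =>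
        rw [Q, Q, ih]
        congr 1
        unfold Wm
        split_ifs
        · ext i j; simp [dlnWmid, hη]
        · rfl
    have h1 : dlnW1 (θ + t • η) = dlnW1 θ := by ext i j; simp [dlnW1, hη]
    have hL : dlnWL (θ + t • η) = dlnWL θ + t • V := by ext i j; simp [dlnWL, hη]
    ext i j
    rw [dlnMatrix_eq, Bm, hQ, h1, hL, Matrix.add_mul, Pi.add_apply, Pi.add_apply, dlnMatrix_eq,
      Matrix.add_apply, Matrix.smul_mul]
    rfl
  have hline : HasDerivAt (fun t : ℝ => θ + t • η) η 0 := by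
    simpa using ((hasDerivAt_id (0 : ℝ)).smul_const η).const_add θ
  have hloss : DifferentiableAt ℝ (dlnLoss C) θ :=
    (hdiff _).comp (g := C) (f := fun θ : DLNParams n0 nL w L => dlnMatrix θ) θ (diff_dlnMatrix θ)
  have h1 : HasFDerivAt (dlnLoss C) (0 : DLNParams n0 nL w L →L[ℝ] ℝ) (θ + (0 : ℝ) • η) := by
    have := hloss.hasFDerivAt
    rw [hθ] at this
    simpa using this
  have h2 := h1.comp_hasDerivAt (0 : ℝ) hline
  have hline' : HasDerivAt (fun t : ℝ => dlnMatrix θ + t • (fun i j => (V * Bm θ) i j))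
      (fun i j => (V * Bm θ) i j) 0 := by
    simpa using ((hasDerivAt_id (0 : ℝ)).smul_const (fun i j => (V * Bm θ) i j)).const_add (dlnMatrix θ)
  have h3 : HasFDerivAt C (fderiv ℝ C (dlnMatrix θ))
      (dlnMatrix θ + (0 : ℝ) • (fun i j => (V * Bm θ) i j)) := by
    simpa using (hdiff (dlnMatrix θ)).hasFDerivAt
  have h4 := h3.comp_hasDerivAt (0 : ℝ) hline'
  have h5 : (dlnLoss C ∘ fun t : ℝ => θ + t • η)
      = C ∘ fun t : ℝ => dlnMatrix θ + t • (fun i j => (V * Bm θ) i j) := by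
    ext t; simp [dlnLoss, hmat]
  rw [h5] at h2
  simpa using h4.unique h2

/-- at a saddle, the product of all but the last layer is not injective -/
lemma saddle_not_injective {C : (Fin nL → Fin n0 → ℝ) → ℝ} (hconv : ConvexOn ℝ Set.univ C)
    (hdiff : Differentiable ℝ C) (θ : DLNParams n0 nL w L) (hθ : DLNIsSaddle C θ) :
    ¬ Function.Injective (Bm θ).mulVec := by
  intro hinj
  apply hθ.2
  obtain ⟨N, hN⟩ : ∃ N : Matrix (Fin n0) (Fin w) ℝ, N * Bm θ = 1 := by
    obtain ⟨g, hg⟩ := LinearMap.exists_leftInverse_of_injective (Bm θ).mulVecLin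
      (LinearMap.ker_eq_bot.2 hinj)
    refine ⟨LinearMap.toMatrix' g, ?_⟩
    have := congrArg LinearMap.toMatrix' hg
    rw [LinearMap.toMatrix'_comp, LinearMap.toMatrix'_id] at this
    rw [← this]
    congr 1
    exact (LinearMap.toMatrix'_toLin' _).symm
  have hzero : fderiv ℝ C (dlnMatrix θ) = 0 := by
    ext X
    have := critical_last hdiff θ hθ.1 ((Matrix.of X) * N)
    rw [Matrix.mul_assoc, hN, Matrix.mul_one] at this
    simpa using this
  have hmin : IsMinOn C Set.univ (dlnMatrix θ) := by
    intro X _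
    by_contra hlt
    simp only [Set.mem_ofPred_eq, not_le] at hlt
    have hline : HasDerivAt (fun t : ℝ => dlnMatrix θ + t • (X - dlnMatrix θ))
        (X - dlnMatrix θ) 0 := by
      simpa using ((hasDerivAt_id (0 : ℝ)).smul_const (X - dlnMatrix θ)).const_add (dlnMatrix θ)
    have h3 : HasFDerivAt C (0 : (Fin nL → Fin n0 → ℝ) →L[ℝ] ℝ)
        (dlnMatrix θ + (0 : ℝ) • (X - dlnMatrix θ)) := by
      rw [← hzero]
      simpa using (hdiff (dlnMatrix θ)).hasFDerivAt
    have h4 := h3.comp_hasDerivAt (0 : ℝ) hline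
    have h5 := h4.tendsto_slope_zero_right
    have h6 : ∀ᶠ t : ℝ in nhdsWithin 0 (Set.Ioi 0), t ∈ Set.Ioo (0 : ℝ) 1 :=
      Ioo_mem_nhdsGT one_pos
    have h7 : (0 : ℝ) ≤ C X - C (dlnMatrix θ) := by
      refine le_of_tendsto h5 ?_
      filter_upwards [h6] with t ht
      have hc := hconv.2 (Set.mem_univ (dlnMatrix θ)) (Set.mem_univ X)
        (show (0 : ℝ) ≤ 1 - t by linarith [ht.2]) ht.1.le (by ring)
      have he : (1 - t) • dlnMatrix θ + t • X = dlnMatrix θ + t • (X - dlnMatrix θ) := by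
        rw [sub_smul, one_smul, smul_sub]; abel
      rw [he] at hc
      simp only [smul_eq_mul] at hc
      simp only [Function.comp, zero_add, zero_smul, add_zero, smul_eq_mul]
      rw [inv_mul_le_iff₀ ht.1]
      linarith
    linarith
  refine Filter.Eventually.of_forall fun θ' => hmin (Set.mem_univ (dlnMatrix θ'))

end tw
end DLNAux

namespace DLNAux
section asym
open scoped Matrix.Norms.L2Operator
open Filter Topology

/-- the family of events has probability tending to zero -/
def TZ (n0 nL L : ℕ) (E : ∀ w : ℕ, Set (DLNParams n0 nL w L)) : Prop :=
  Tendsto (fun w : ℕ => dlnGauss n0 nL w L ((w : ℝ) ^ (-(1 : ℝ))) (E w)) atTop (𝓝 0)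

lemma TZ.mono {E F : ∀ w : ℕ, Set (DLNParams n0 nL w L)} (hF : TZ n0 nL L F)
    (h : ∀ᶠ w in atTop, E w ⊆ F w) : TZ n0 nL L E := by
  refine tendsto_of_tendsto_of_tendsto_of_le_of_le' tendsto_const_nhds hF
    (Eventually.of_forall fun w => zero_le) ?_
  filter_upwards [h] with w hw
  exact measure_mono hw

lemma TZ.union {E F : ∀ w : ℕ, Set (DLNParams n0 nL w L)} (hE : TZ n0 nL L E)
    (hF : TZ n0 nL L F) : TZ n0 nL L (fun w => E w ∪ F w) := by
  have h := Tendsto.add hE hF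
  rw [add_zero] at h
  exact tendsto_of_tendsto_of_tendsto_of_le_of_le tendsto_const_nhds h
    (fun w => zero_le) (fun w => measure_union_le _ _)

lemma TZ.iUnion {ι : Type*} (s : Finset ι) {E : ι → ∀ w : ℕ, Set (DLNParams n0 nL w L)}
    (hE : ∀ i, TZ n0 nL L (E i)) : TZ n0 nL L (fun w => ⋃ i ∈ s, E i w) := by
  have h := tendsto_finsetSum (s := s) fun i _ => hE i
  rw [Finset.sum_const_zero] at h
  exact tendsto_of_tendsto_of_tendsto_of_le_of_le tendsto_const_nhds h
    (fun w => zero_le) (fun w => measure_biUnion_finset_le _ _)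

lemma TZ.of_bound {E : ∀ w : ℕ, Set (DLNParams n0 nL w L)} (f : ℕ → ℝ)
    (hf : Tendsto f atTop (𝓝 0))
    (h : ∀ᶠ w : ℕ in atTop, ∀ s2 : NNReal, (s2 : ℝ) * w = 1 →
      (Measure.pi fun _ : DLNIdx n0 nL w L => gaussianReal 0 s2) (E w) ≤ ENNReal.ofReal (f w)) :
    TZ n0 nL L E := by
  have h1 : Tendsto (fun w => ENNReal.ofReal (f w)) atTop (𝓝 0) := by
    simpa using ENNReal.tendsto_ofReal hf
  refine tendsto_of_tendsto_of_tendsto_of_le_of_le' tendsto_const_nhds h1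
    (Eventually.of_forall fun w => zero_le) ?_
  filter_upwards [h, eventually_ge_atTop 1] with w hw hw1
  refine hw _ ?_
  have hpos : (0 : ℝ) < w := by exact_mod_cast hw1
  rw [Real.coe_toNNReal _ (by positivity), Real.rpow_neg_one, inv_mul_cancel₀ hpos.ne']

lemma tz_op (m n : ℕ → ℕ) (hm : ∀ᶠ w in atTop, m w ≤ w) (hn : ∀ᶠ w in atTop, n w ≤ w)
    (e : ∀ w, Fin (m w) → Fin (n w) → DLNIdx n0 nL w L)
    (he : ∀ w i j i' j', e w i j = e w i' j' → i = i' ∧ j = j') :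
    TZ n0 nL L (fun w => {θ | 11 < ‖(Matrix.of fun i j => θ (e w i j) :
      Matrix (Fin (m w)) (Fin (n w)) ℝ)‖}) := by
  have hr : 4 * Real.exp (-3) < 1 := by
    have : (3 : ℝ) + 1 < Real.exp 3 := Real.add_one_lt_exp (by norm_num)
    rw [Real.exp_neg, ← div_eq_mul_inv, div_lt_one (Real.exp_pos _)]
    linarith
  refine TZ.of_bound (fun w => (4 * Real.exp (-3)) ^ w)
    (tendsto_pow_atTop_nhds_zero_of_lt_one (by positivity) hr) ?_
  filter_upwards [hm, hn] with w hm hn s2 hs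
  refine (op_block s2 hs (e w) (he w) 11 (by norm_num)).trans (ENNReal.ofReal_le_ofReal ?_)
  rw [mul_pow, ← Real.exp_nat_mul]
  have h1 : (w : ℝ) * (8 - 11) = w * -3 := by norm_num
  rw [h1]
  refine mul_le_mul_of_nonneg_right ?_ (Real.exp_pos _).le
  calc (2 : ℝ) ^ (m w + n w) ≤ 2 ^ (2 * w) := pow_le_pow_right₀ (by norm_num) (by omega)
    _ = 4 ^ w := by rw [pow_mul]; norm_num

lemma tz_good : TZ n0 nL L (fun w => {θ | ¬ Good 11 θ}) := by
  have h1 := tz_op (n0 := n0) (nL := nL) (L := L) (fun w => w) (fun _ => n0)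
    (Eventually.of_forall fun w => le_rfl) (eventually_ge_atTop n0)
    (fun w i j => Sum.inl (i, j)) (by intro w i j i' j' h; simpa using h)
  have h2 := tz_op (n0 := n0) (nL := nL) (L := L) (fun _ => nL) (fun w => w)
    (eventually_ge_atTop nL) (Eventually.of_forall fun w => le_rfl)
    (fun w i j => Sum.inr (Sum.inr (i, j))) (by intro w i j i' j' h; simpa using h)
  have h3 := fun l : Fin (L - 2) => tz_op (n0 := n0) (nL := nL) (L := L) (fun w => w) (fun w => w)
    (Eventually.of_forall fun w => le_rfl) (Eventually.of_forall fun w => le_rfl)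
    (fun w i j => Sum.inr (Sum.inl (l, i, j))) (by intro w i j i' j' h; simpa using h)
  refine ((h1.union h2).union (TZ.iUnion Finset.univ h3)).mono (Eventually.of_forall fun w θ hθ => ?_)
  by_contra hcon
  simp only [Set.mem_union, not_or, Set.mem_iUnion, not_exists, Finset.mem_univ] at hcon
  refine hθ ⟨not_lt.1 hcon.1.1, not_lt.1 hcon.1.2, fun l => not_lt.1 (hcon.2 l trivial)⟩

lemma Wm_congr {θ θ' : DLNParams n0 nL w L} (k : ℕ)
    (h : ∀ l i j, l.val = k → θ (Sum.inr (Sum.inl (l, i, j))) = θ' (Sum.inr (Sum.inl (l, i, j)))) :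
    Wm θ k = Wm θ' k := by
  unfold Wm
  split_ifs with hk
  · ext i j
    exact h ⟨k, hk⟩ i j rfl
  · rfl

lemma Q_congr {θ θ' : DLNParams n0 nL w L} (k : ℕ)
    (h : ∀ l i j, l.val < k → θ (Sum.inr (Sum.inl (l, i, j))) = θ' (Sum.inr (Sum.inl (l, i, j)))) :
    Q θ k = Q θ' k := by
  induction k with
  | zero => rfl
  | succ k ih =>
    rw [Q, Q, ih fun l i j hl => h l i j (by omega), Wm_congr k fun l i j hl => h l i j (by omega)]

lemma W1_congr {θ θ' : DLNParams n0 nL w L}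
    (h : ∀ i j, θ (Sum.inl (i, j)) = θ' (Sum.inl (i, j))) : dlnW1 θ = dlnW1 θ' := by
  ext i j; exact h i j

lemma tz_entry (δ : ℝ) (hδ : 0 < δ) :
    TZ n0 nL L (fun w => {θ | Good 11 θ ∧ ∃ i j, δ ≤ |dlnMatrix θ i j|}) := by
  set K' : ℝ := (11 ^ (L - 2) * 11) ^ 2 with hK'
  have htend : Tendsto (fun w : ℕ => Real.exp (K' / 2 - Real.sqrt w * δ)) atTop (𝓝 0) := by
    refine Real.tendsto_exp_atBot.comp ?_
    refine tendsto_atBot_add_const_left _ _ ?_ |>.congr fun w => (sub_eq_add_neg _ _).symm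
    refine tendsto_neg_atTop_atBot.comp ?_
    exact (Real.tendsto_sqrt_atTop.comp tendsto_natCast_atTop_atTop).atTop_mul_const hδ
  have key : ∀ (σ : ℝ), σ ^ 2 = 1 → ∀ (i : Fin nL) (j : Fin n0), TZ n0 nL L (fun w =>
      {θ | δ ≤ ∑ k : Fin w, θ (Sum.inr (Sum.inr (i, k))) * (σ * Bm θ k j) ∧
        ∑ k : Fin w, (σ * Bm θ k j) ^ 2 ≤ K'}) := by
    intro σ hσ i j
    refine TZ.of_bound _ htend (Eventually.of_forall fun w s2 hs => ?_)
    refine upper_row s2 hs (fun k : Fin w => Sum.inr (Sum.inr (i, k))) ?_ δ K'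
      (fun θ k => σ * Bm θ k j) ?_ ?_
    · intro a b h; simpa using h
    · refine measurable_pi_lambda _ fun k => ?_
      exact ((diff_Bm k j).continuous.measurable).const_mul σ
    · intro θ θ' h
      have : Bm θ = Bm θ' := by
        unfold Bm
        rw [Q_congr (θ := θ) (θ' := θ') (L - 2) fun l i j _ => h _ (by simp),
          W1_congr (θ := θ) (θ' := θ') fun i j => h _ (by simp)]
      simp only [this]
  have hu := TZ.iUnion (Finset.univ : Finset (Fin nL × Fin n0)) fun p =>
    (key 1 (by norm_num) p.1 p.2).union (key (-1) (by norm_num) p.1 p.2)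
  refine hu.mono (Eventually.of_forall fun w θ hθ => ?_)
  obtain ⟨hg, i, j, hij⟩ := hθ
  have hcol : ∑ k : Fin w, (Bm θ k j) ^ 2 ≤ K' :=
    (col_sq_le (Bm θ) j).trans (pow_le_pow_left₀ (norm_nonneg _) (hg.Bm (by norm_num)) 2)
  have hA : dlnMatrix θ i j = ∑ k : Fin w, θ (Sum.inr (Sum.inr (i, k))) * Bm θ k j := by
    rw [dlnMatrix_eq, Matrix.mul_apply]; rfl
  simp only [Set.mem_iUnion, Finset.mem_univ]
  refine ⟨(i, j), trivial, ?_⟩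
  rcases le_abs.1 hij with h | h
  · left
    refine ⟨?_, ?_⟩
    · simpa [hA] using h
    · simpa using hcol
  · right
    refine ⟨?_, ?_⟩
    · simpa [hA] using h
    · simpa using hcol

lemma measurable_v (k : ℕ) (x : Fin n0 → ℝ) : Measurable (fun θ : DLNParams n0 nL w L =>
    (Q θ k).mulVec ((dlnW1 θ).mulVec x)) := by
  refine measurable_pi_lambda _ fun i => ?_
  simp only [Matrix.mulVec, dotProduct]
  refine Finset.measurable_fun_sum _ fun l _ => ?_
  refine ((diff_Q k i l).continuous.measurable).mul ?_
  refine Finset.measurable_fun_sum _ fun j _ => ?_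
  simp only [dlnW1, Matrix.of_apply]
  fun_prop

lemma tz_lower {c q : ℝ} (hc : 0 < c) (hq0 : 0 ≤ q) (hq1 : q < 1)
    (hcq : ∀ w : ℕ, (Measure.pi fun _ : Fin w => gaussianReal 0 1) {z | ∑ i, z i ^ 2 < c * w}
      ≤ ENNReal.ofReal (q ^ w)) (x : Fin n0 → ℝ) (k : ℕ) (hk : k ≤ L - 2) :
    TZ n0 nL L (fun w => {θ | ∑ i, ((Q θ k).mulVec ((dlnW1 θ).mulVec x)) i ^ 2
      < c ^ (k + 1) * ∑ j, x j ^ 2}) := by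
  have hq := tendsto_pow_atTop_nhds_zero_of_lt_one hq0 hq1
  induction k with
  | zero =>
    refine TZ.of_bound _ hq (Eventually.of_forall fun w s2 hs => ?_)
    have := lower_block (κ := DLNIdx n0 nL w L) hcq s2 hs (fun (i : Fin w) (j : Fin n0) => Sum.inl (i, j))
      (by intro i j i' j' h; simpa using h) (fun _ => x) measurable_const (fun _ _ _ => rfl)
    refine le_trans (le_of_eq ?_) this
    congr 1
    ext θ
    simp only [Q, Matrix.one_mulVec]
    simp [Matrix.mulVec, dotProduct, dlnW1]
  | succ k ih =>
    have hkl : k < L - 2 := hk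
    have hb : TZ n0 nL L (fun w => {θ | ∑ i, (∑ j, θ (Sum.inr (Sum.inl (⟨k, hkl⟩, i, j))) *
        ((Q θ k).mulVec ((dlnW1 θ).mulVec x)) j) ^ 2
          < c * ∑ j, ((Q θ k).mulVec ((dlnW1 θ).mulVec x)) j ^ 2}) := by
      refine TZ.of_bound _ hq (Eventually.of_forall fun w s2 hs => ?_)
      refine lower_block (κ := DLNIdx n0 nL w L) hcq s2 hs
        (fun (i : Fin w) (j : Fin w) => Sum.inr (Sum.inl (⟨k, hkl⟩, i, j)))
        (by intro i j i' j' h; simpa using h) (fun θ => (Q θ k).mulVec ((dlnW1 θ).mulVec x))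
        (measurable_v k x) ?_
      intro θ θ' h
      rw [Q_congr (θ := θ) (θ' := θ') k fun l i j hl => h _ ?_,
          W1_congr (θ := θ) (θ' := θ') fun i j => h _ (by simp)]
      intro i' j' heq
      simp at heq
      rw [heq.1] at hl
      simp at hl
    refine (hb.union (ih hkl.le)).mono (Eventually.of_forall fun w θ hθ => ?_)
    by_contra hcon
    simp only [Set.mem_union, not_or, Set.mem_ofPred_eq, not_lt] at hcon hθ
    obtain ⟨h1, h2⟩ := hcon
    have heq : ∀ i, ((Q θ (k + 1)).mulVec ((dlnW1 θ).mulVec x)) i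
        = ∑ j, θ (Sum.inr (Sum.inl (⟨k, hkl⟩, i, j))) * ((Q θ k).mulVec ((dlnW1 θ).mulVec x)) j := by
      intro i
      rw [Q, ← Matrix.mulVec_mulVec]
      simp only [Wm, hkl, dif_pos]
      rfl
    simp only [heq] at hθ
    have h3 := mul_le_mul_of_nonneg_left h2 hc.le
    have h4 : c ^ (k + 1 + 1) * ∑ j, x j ^ 2 = c * (c ^ (k + 1) * ∑ j, x j ^ 2) := by ring
    linarith

lemma inj_of_net {m n : ℕ} (T : Finset (EuclideanSpace ℝ (Fin n))) {η b ρ : ℝ}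
    (hT : ∀ y : EuclideanSpace ℝ (Fin n), ‖y‖ = 1 → ∃ x ∈ T, ‖y - x‖ ≤ η)
    (A A' : Matrix (Fin m) (Fin n) ℝ) (hA : ‖A‖ ≤ b) (hρ : 0 < ρ) (hη : 0 ≤ η) (hb : b * η ≤ ρ / 2)
    (hx : ∀ x ∈ T, ρ ≤ ‖(WithLp.toLp 2 (A.mulVec x) : EuclideanSpace ℝ (Fin m))‖)
    (hA' : ‖A' - A‖ ≤ ρ / 4) : Function.Injective A'.mulVec := by
  rw [← Matrix.coe_mulVecLin, injective_iff_map_eq_zero]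
  intro z hz
  by_contra hne
  set z' : EuclideanSpace ℝ (Fin n) := WithLp.toLp 2 z with hz'
  have hz0 : z' ≠ 0 := by
    intro h
    apply hne
    have := congrArg WithLp.ofLp h
    simpa [hz'] using this
  set y := ‖z'‖⁻¹ • z' with hy
  have hy1 : ‖y‖ = 1 := by
    rw [hy, norm_smul, norm_inv, norm_norm, inv_mul_cancel₀ (norm_ne_zero_iff.2 hz0)]
  have hy0 : A'.mulVec y = 0 := by
    rw [hy]
    simp only [WithLp.ofLp_smul, Matrix.mulVec_smul, hz']
    rw [Matrix.mulVecLin_apply] at hz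
    rw [hz, smul_zero]
  obtain ⟨x, hxT, hxy⟩ := hT y hy1
  have h1 := hx x hxT
  have h2 : (WithLp.toLp 2 (A.mulVec x) : EuclideanSpace ℝ (Fin m))
      = -(WithLp.toLp 2 ((A' - A).mulVec y)) - WithLp.toLp 2 (A.mulVec (y - x)) := by
    rw [Matrix.sub_mulVec, hy0]
    simp [Matrix.mulVec_sub]
  have h3 := Matrix.l2_opNorm_mulVec (A' - A) y
  have h4 := Matrix.l2_opNorm_mulVec A (y - x)
  rw [h2] at h1
  have h5 := h1.trans (norm_sub_le _ _)
  rw [norm_neg] at h5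
  rw [hy1, mul_one] at h3
  have h6 : ‖A‖ * ‖y - x‖ ≤ b * η := mul_le_mul hA hxy (norm_nonneg _) ((norm_nonneg _).trans hA)
  have h7 : ‖(WithLp.toLp 2 ((A' - A).mulVec y) : EuclideanSpace ℝ (Fin m))‖ ≤ ρ / 4 := h3.trans hA'
  have h8 : ‖(WithLp.toLp 2 (A.mulVec (y - x)) : EuclideanSpace ℝ (Fin m))‖ ≤ ρ / 2 :=
    h4.trans (h6.trans hb)
  have : ρ ≤ ρ / 4 + ρ / 2 := h5.trans (add_le_add h7 h8)
  linarith

/-- with high probability, all small perturbations of the parameters keep `Bm` injective -/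
lemma tz_inj (n0 nL L : ℕ) : ∃ κ : ℝ, 0 < κ ∧
    TZ n0 nL L (fun w => {θ | Good 11 θ ∧
      ∃ A' : Matrix (Fin w) (Fin n0) ℝ, ‖A' - Bm θ‖ ≤ κ ∧ ¬ Function.Injective A'.mulVec}) := by
  obtain ⟨c, q, hc, hq0, hq1, hcq⟩ := exists_lower_const
  set ρ : ℝ := Real.sqrt (c ^ (L - 2 + 1)) with hρ
  have hρ0 : 0 < ρ := Real.sqrt_pos.2 (by positivity)
  set b : ℝ := 11 ^ (L - 2) * 11 with hb
  have hb0 : 0 < b := by positivity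
  set η : ℝ := ρ / 2 / b with hη
  have hη0 : 0 < η := by positivity
  obtain ⟨t, hts, htf, hcov⟩ := (isCompact_sphere (0 : EuclideanSpace ℝ (Fin n0)) 1).finite_cover_balls hη0
  refine ⟨ρ / 4, by positivity, ?_⟩
  have hu := TZ.iUnion htf.toFinset fun x : EuclideanSpace ℝ (Fin n0) =>
    tz_lower (nL := nL) (L := L) hc hq0 hq1 hcq (fun j => x j) (L - 2) le_rfl
  refine hu.mono (Eventually.of_forall fun w θ hθ => ?_)
  obtain ⟨hg, A', hA', hinj⟩ := hθ
  by_contra hcon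
  simp only [Set.mem_iUnion, not_exists, Set.mem_ofPred_eq, not_lt] at hcon
  apply hinj
  refine inj_of_net htf.toFinset (η := η) ?_ (Bm θ) A' (hg.Bm (by norm_num)) hρ0 hη0.le ?_ ?_ hA'
  · intro y hy
    have : y ∈ Metric.sphere (0 : EuclideanSpace ℝ (Fin n0)) 1 := by simpa using hy
    have h2 := hcov this
    simp only [Set.mem_iUnion] at h2
    obtain ⟨x, hx, hxy⟩ := h2
    refine ⟨x, by simpa using hx, ?_⟩
    rw [Metric.mem_ball, dist_eq_norm] at hxy
    exact hxy.le
  · rw [hη, mul_div_cancel₀ _ hb0.ne']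
  · intro x hx
    have h1 := hcon x hx
    have hx1 : ‖x‖ = 1 := by
      have := hts (by simpa using hx : x ∈ t)
      simpa using this
    have hx2 : ∑ j, x j ^ 2 = 1 := by
      rw [← EuclideanSpace.real_norm_sq_eq, hx1, one_pow]
    rw [hx2, mul_one, Matrix.mulVec_mulVec] at h1
    rw [hρ]
    refine Real.sqrt_le_iff.2 ⟨norm_nonneg _, ?_⟩
    rw [EuclideanSpace.real_norm_sq_eq]
    exact h1

end asym
end DLNAux

namespace DLNAux
section fin
open scoped Matrix.Norms.L2Operator
open Filter Topology

lemma sInf_dist_le {S : Set (DLNParams n0 nL w L)} {θ θ' : DLNParams n0 nL w L} (h : θ' ∈ S)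
    {M : ℝ} (hM : dlnDist θ θ' ≤ M) : sInf ((fun θ' => dlnDist θ θ') '' S) ≤ M := by
  have hb : BddBelow ((fun θ' => dlnDist θ θ') '' S) := by
    refine ⟨0, ?_⟩
    rintro _ ⟨τ, _, rfl⟩
    exact Real.sqrt_nonneg _
  exact (csInf_le hb ⟨θ', h, rfl⟩).trans hM

lemma le_sInf_dist {S : Set (DLNParams n0 nL w L)} {θ : DLNParams n0 nL w L} (h : S.Nonempty)
    {r : ℝ} (hr : ∀ θ' ∈ S, ¬ dlnDist θ θ' ≤ r) : r ≤ sInf ((fun θ' => dlnDist θ θ') '' S) := by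
  refine le_csInf (h.image _) ?_
  rintro _ ⟨τ, hτ, rfl⟩
  exact (not_le.1 (hr τ hτ)).le

lemma main (L n0 nL : ℕ) (C : (Fin nL → Fin n0 → ℝ) → ℝ)
    (hconv : ConvexOn ℝ Set.univ C) (hdiff : Differentiable ℝ C)
    (hne : {A : Fin nL → Fin n0 → ℝ | ∀ B, C A ≤ C B}.Nonempty)
    (h0 : ¬ (∀ B, C (0 : Fin nL → Fin n0 → ℝ) ≤ C B)) :
    ∃ M r : ℝ, 0 < r ∧ TZ n0 nL L (fun w => {θ | ¬ ((dlnDm C θ ≤ M ∧ r ≤ dlnDm C θ) ∧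
      (dlnDs C θ ≤ M ∧ r ≤ dlnDs C θ))}) := by
  obtain ⟨D, hD⟩ := hne
  simp only [Set.mem_ofPred_eq] at hD
  push Not at h0
  obtain ⟨B, hB⟩ := h0
  obtain ⟨P, hP, hpert⟩ := exists_pert L 11 (by norm_num)
  obtain ⟨κ, hκ, htz⟩ := tz_inj n0 nL L
  obtain ⟨δ, hδ, hδC⟩ : ∃ δ : ℝ, 0 < δ ∧ ∀ A : Fin nL → Fin n0 → ℝ, (∀ i j, |A i j| < δ) → C B < C A := by
    have hev : ∀ᶠ A in 𝓝 (0 : Fin nL → Fin n0 → ℝ), C B < C A :=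
      hdiff.continuous.continuousAt.eventually (lt_mem_nhds hB)
    obtain ⟨δ, hδ, hball⟩ := Metric.eventually_nhds_iff.1 hev
    refine ⟨δ, hδ, fun A hA => hball ?_⟩
    rw [dist_zero_right]
    refine (pi_norm_lt_iff hδ).2 fun i => (pi_norm_lt_iff hδ).2 fun j => ?_
    simpa using hA i j
  set r : ℝ := min 1 (min (κ / P) (δ / 2 / P)) with hr
  have hr0 : 0 < r := by positivity
  have hr1 : r ≤ 1 := min_le_left _ _
  have hrκ : P * r ≤ κ := by
    have : r ≤ κ / P := (min_le_right _ _).trans (min_le_left _ _)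
    rw [le_div_iff₀ hP] at this
    linarith
  have hrδ : P * r ≤ δ / 2 := by
    have : r ≤ δ / 2 / P := (min_le_right _ _).trans (min_le_right _ _)
    rw [le_div_iff₀ hP] at this
    linarith
  set bd : ℝ → (Fin nL → Fin n0 → ℝ) → ℝ := fun a D =>
    Real.sqrt (n0 * (2 * (11 : ℝ) ^ 2 + 2 * a ^ 2) +
      ((L - 2 : ℕ) * (n0 * (2 * (11 : ℝ) ^ 2 + 2)) + (nL * (2 * (11 : ℝ) ^ 2) + 2 * ∑ i, ∑ j, D i j ^ 2)))
    with hbd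
  refine ⟨max (bd 1 D) (bd 0 0), r, hr0, ?_⟩
  refine ((tz_good.union (tz_entry (δ / 2) (by positivity))).union htz).mono ?_
  filter_upwards [eventually_ge_atTop n0] with w hw θ hθ
  by_contra hcon
  simp only [Set.mem_union, not_or, Set.mem_ofPred_eq, not_not] at hcon
  obtain ⟨⟨hg, hent⟩, hinj⟩ := hcon
  apply hθ
  have hmin : tweak θ 1 D ∈ {θ' : DLNParams n0 nL w L | DLNIsGlobalMin C θ'} := by
    intro A
    rw [tweak_matrix hw, one_smul]
    exact hD A
  have hsad : tweak θ 0 0 ∈ {θ' : DLNParams n0 nL w L | DLNIsSaddle C θ'} :=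
    tweak_saddle hw hconv hdiff hB θ
  refine ⟨⟨?_, ?_⟩, ?_, ?_⟩
  · exact sInf_dist_le hmin ((tweak_dist hw hg 1 D).trans (le_max_left _ _))
  · refine le_sInf_dist ⟨_, hmin⟩ fun θ' hθ' hd => ?_
    have h1 := (hpert n0 nL w r hr1 θ θ' hg hd).2
    have h2 := hδC (dlnMatrix θ') fun i j => by
      have h3 : |dlnMatrix θ i j| < δ / 2 := by
        by_contra hh
        exact hent ⟨hg, i, j, not_lt.1 hh⟩
      have h4 := h1 i j
      have h5 := abs_add_le (dlnMatrix θ i j) (dlnMatrix θ' i j - dlnMatrix θ i j)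
      rw [add_sub_cancel] at h5
      linarith
    exact absurd (hθ' B) (not_le.2 h2)
  · exact sInf_dist_le hsad ((tweak_dist hw hg 0 0).trans (le_max_right _ _))
  · refine le_sInf_dist ⟨_, hsad⟩ fun θ' hθ' hd => ?_
    have h1 := (hpert n0 nL w r hr1 θ θ' hg hd).1
    exact hinj ⟨hg, Bm θ', h1.trans hrκ, saddle_not_injective hconv hdiff θ' hθ'⟩

lemma conclude {n0 nL L : ℕ} {M r : ℝ} (hr : 0 < r) (d : ∀ w, DLNParams n0 nL w L → ℝ)
    (h : TZ n0 nL L (fun w => {θ | ¬ (d w θ ≤ M ∧ r ≤ d w θ)})) :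
    ∀ ε : ℝ, 0 < ε → ∃ (M : ℝ) (w₀ : ℕ), ∀ w : ℕ, w₀ ≤ w →
        dlnGauss n0 nL w L ((w : ℝ) ^ (-(1 : ℝ)))
            {θ | d w θ > M * 1} < ENNReal.ofReal ε ∧
        dlnGauss n0 nL w L ((w : ℝ) ^ (-(1 : ℝ)))
            {θ | (1 : ℝ) > M * d w θ} < ENNReal.ofReal ε := by
  intro ε hε
  have hev := Tendsto.eventually_lt_const (ENNReal.ofReal_pos.2 hε) h
  obtain ⟨w₀, hw₀⟩ := eventually_atTop.1 hev
  refine ⟨max M (1 / r), w₀, fun w hw => ⟨?_, ?_⟩⟩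
  · refine (measure_mono ?_).trans_lt (hw₀ w hw)
    intro θ hθ hcon
    simp only [Set.mem_ofPred_eq, mul_one] at hθ
    exact absurd (hcon.1.trans (le_max_left _ (1 / r))) (not_le.2 hθ)
  · refine (measure_mono ?_).trans_lt (hw₀ w hw)
    intro θ hθ hcon
    simp only [Set.mem_ofPred_eq] at hθ
    have h1 : 1 / r * r ≤ max M (1 / r) * d w θ :=
      mul_le_mul (le_max_right _ _) hcon.2 hr.le ((by positivity : (0 : ℝ) ≤ 1 / r).trans (le_max_right _ _))
    rw [one_div, inv_mul_cancel₀ hr.ne'] at h1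
    rw [one_div] at hθ
    linarith

end fin
end DLNAux

/-- **Distances to critical points at initialization, Mean-Field regime (`γ = 1`).**
With i.i.d. `N(0, w^{-1})` initialization, `d_m ≍ 1` and `d_s ≍ 1` as `w → ∞`. -/
theorem dln_distances_mean_field_regime
    (L n0 nL : ℕ) (hL : 2 ≤ L)
    (C : (Fin nL → Fin n0 → ℝ) → ℝ)
    (hconv : ConvexOn ℝ Set.univ C) (hdiff : Differentiable ℝ C)
    (hne : {A : Fin nL → Fin n0 → ℝ | ∀ B, C A ≤ C B}.Nonempty)
    (hnull : volume {A : Fin nL → Fin n0 → ℝ | ∀ B, C A ≤ C B} = 0)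
    (h0 : ¬ (∀ B, C (0 : Fin nL → Fin n0 → ℝ) ≤ C B)) :
    (∀ ε : ℝ, 0 < ε → ∃ (M : ℝ) (w₀ : ℕ), ∀ w : ℕ, w₀ ≤ w →
        dlnGauss n0 nL w L ((w : ℝ) ^ (-(1 : ℝ)))
            {θ | dlnDm C θ > M * 1} < ENNReal.ofReal ε ∧
        dlnGauss n0 nL w L ((w : ℝ) ^ (-(1 : ℝ)))
            {θ | (1 : ℝ) > M * dlnDm C θ} < ENNReal.ofReal ε) ∧
    (∀ ε : ℝ, 0 < ε → ∃ (M : ℝ) (w₀ : ℕ), ∀ w : ℕ, w₀ ≤ w →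
        dlnGauss n0 nL w L ((w : ℝ) ^ (-(1 : ℝ)))
            {θ | dlnDs C θ > M * 1} < ENNReal.ofReal ε ∧
        dlnGauss n0 nL w L ((w : ℝ) ^ (-(1 : ℝ)))
            {θ | (1 : ℝ) > M * dlnDs C θ} < ENNReal.ofReal ε) := by
  obtain ⟨M, r, hr, h⟩ := DLNAux.main L n0 nL C hconv hdiff hne h0
  refine ⟨?_, ?_⟩
  · exact DLNAux.conclude hr (fun w θ => dlnDm C θ) (h.mono (Filter.Eventually.of_forall
      fun w θ hθ hcon => hθ hcon.1))
  · exact DLNAux.conclude hr (fun w θ => dlnDs C θ) (h.mono (Filter.Eventually.of_forall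
      fun w θ hθ hcon => hθ hcon.2))
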